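/- arXiv:1906.07173 — 2 statements merged into one kernel-verified Lean document; each statement's English description precedes it below -/
import Mathlib

section
/- Let ε∈(0,1], τ>0, d∈ℕ, η₁≥1, and set δ = min{δ₀, εα/(8(d+β+2)), ε/(dη₁²)}. There exists a constant c such that for all t∈(0,τ] and x,u,w∈ℝ: (1) g_t^{(δ)}(x) ≤ c·tilde-g_t^{(ε)}(x); (2) |g_t^{(δ)}(x+u) − g_t^{(δ)}(x)| ≤ c·(|u|/h^{−1}(1/t))·(tilde-g_t^{(ε)}(x+u)+tilde-g_t^{(ε)}(x)); (3) |g_t^{(δ)}(x+u)+g_t^{(δ)}(x−u)−2g_t^{(δ)}(x)| ≤ c·(|u|²/(h^{−1}(1/t))²)·max_{ξ∈[x−|u|,x+|u|]} tilde-g_t^{(ε)}(ξ); (4) |g_t^{(δ)}(x+u)+g_t^{(δ)}(x−u)−g_t^{(δ)}(x+w)−g_t^{(δ)}(x−w)| ≤ c·(| |u|²−|w|² |/(h^{−1}(1/t))²)·(g*_t(x+u)+g*_t(x−u)+g*_t(x+w)+g*_t(x−w)). -/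
open Filter MeasureTheory

/-- `g*_t(x) = (1/h^{-1}(1/t)) ∧ (t h(|x|)/|x|)`, with the convention `h(0)/0 = ∞`. -/
noncomputable def gstar (h hinv : ℝ → ℝ) (t x : ℝ) : ℝ :=
  if x = 0 then 1 / hinv (1 / t) else min (1 / hinv (1 / t)) (t * h |x| / |x|)

/-- The majorant `tilde-g_t^{(ε)}(x)`: equal to `(1/h^{-1}(1/t)) ∧ (t h(|x|)/|x|)` for
`|x| < ε` (with `h(0)/0 = ∞`) and to `c_ε t^p e^{-|x|}` for `|x| ≥ ε`, where
`p = (d+β-1)/α` and `c_ε = ((1/h^{-1}(1/τ)) ∧ (τ h(ε)/ε)) e^ε τ^{-p}`. -/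
noncomputable def tg (h hinv : ℝ → ℝ) (τ ε p t x : ℝ) : ℝ :=
  if x = 0 then 1 / hinv (1 / t)
  else if |x| < ε then min (1 / hinv (1 / t)) (t * h |x| / |x|)
  else min (1 / hinv (1 / τ)) (τ * h ε / ε) * Real.exp ε / τ ^ p *
    (t ^ p * Real.exp (-|x|))

lemma int_bd {R : ℝ} (hR : 0 < R) : Integrable (fun ξ : ℝ => (1 + (ξ * R) ^ 2)⁻¹) :=
  (integrable_inv_one_add_sq).comp_mul_right' hR.ne'

lemma integral_bd {R : ℝ} (hR : 0 < R) : ∫ ξ : ℝ, (1 + (ξ * R) ^ 2)⁻¹ = Real.pi / R := by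
  have := Measure.integral_comp_mul_right (fun s : ℝ => (1 + s ^ 2)⁻¹) R
  rw [this, integral_univ_inv_one_add_sq, abs_of_pos (by positivity), smul_eq_mul]
  ring

lemma tend_bd {R : ℝ} (hR : 0 < R) (K : ℝ) :
    Tendsto (fun ξ : ℝ => K * (1 + (ξ * R) ^ 2)⁻¹) atTop (nhds 0) := by
  rw [show (0:ℝ) = K * 0 by ring]
  refine Tendsto.const_mul _ ?_
  apply Filter.Tendsto.inv_tendsto_atTop
  apply tendsto_atTop_add_const_left
  exact (tendsto_pow_atTop two_ne_zero).comp (tendsto_id.atTop_mul_const hR)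

lemma contour (F : ℂ → ℂ) (hF : Differentiable ℂ F) {R K l : ℝ} (hR : 0 < R)
    (hb : ∀ ξ y : ℝ, |y| ≤ |l| → ‖F (ξ + y * Complex.I)‖ ≤ K * (1 + (ξ * R) ^ 2)⁻¹) :
    ∫ ξ : ℝ, F ξ = ∫ ξ : ℝ, F (ξ + l * Complex.I) := by
  have hFc := hF.continuous
  have intl : ∀ y : ℝ, |y| ≤ |l| → Integrable (fun ξ : ℝ => F (ξ + y * Complex.I)) := by
    intro y hy
    refine Integrable.mono' ((int_bd hR).const_mul K) ?_ (Eventually.of_forall fun ξ => hb ξ y hy)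
    exact (hFc.comp (by fun_prop)).aestronglyMeasurable
  have i0 : Integrable (fun ξ : ℝ => F ξ) := by simpa using intl 0 (by simp)
  have t1 := intervalIntegral_tendsto_integral (intl l le_rfl) tendsto_neg_atTop_atBot tendsto_id
  have t2 := intervalIntegral_tendsto_integral i0 tendsto_neg_atTop_atBot tendsto_id
  have key : ∀ T : ℝ, (∫ ξ : ℝ in -T..T, F ξ) - (∫ ξ : ℝ in -T..T, F (ξ + l * Complex.I))
      = Complex.I * (∫ y : ℝ in (0:ℝ)..l, F (-T + y * Complex.I))
        - Complex.I * (∫ y : ℝ in (0:ℝ)..l, F (T + y * Complex.I)) := by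
    intro T
    have := Complex.integral_boundary_rect_eq_zero_of_differentiableOn F (-T)
        (T + l * Complex.I) hF.differentiableOn
    simp only [Complex.neg_im, Complex.ofReal_im, neg_zero, Complex.ofReal_zero, zero_mul, add_zero,
      Complex.neg_re,
      Complex.ofReal_re, Complex.add_re, Complex.mul_re, Complex.I_re, mul_zero, Complex.I_im,
      tsub_zero, Complex.add_im, Complex.mul_im,
      mul_one, zero_add, smul_eq_mul, Complex.ofReal_neg] at this
    linear_combination this
  have vert : ∀ s : ℝ → ℝ, (∀ T, |s T| = |T|) → Tendsto (fun T : ℝ => Complex.I *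
      (∫ y : ℝ in (0:ℝ)..l, F ((s T : ℝ) + y * Complex.I))) atTop (nhds 0) := by
    intro s hs
    rw [tendsto_zero_iff_norm_tendsto_zero]
    have h0 : Tendsto (fun T : ℝ => (K * (1 + (T * R) ^ 2)⁻¹) * |l|) atTop (nhds 0) := by
      simpa using (tend_bd hR K).mul_const |l|
    refine squeeze_zero (fun _ => norm_nonneg _) (fun T => ?_) h0
    rw [norm_mul, Complex.norm_I, one_mul]
    have := intervalIntegral.norm_integral_le_of_norm_le_const (a := (0:ℝ)) (b := l)
      (C := K * (1 + (T * R) ^ 2)⁻¹) (f := fun y : ℝ => F ((s T : ℝ) + y * Complex.I)) ?_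
    · simpa using this
    · intro y hy
      have hy' : |y| ≤ |l| := by
        simpa using Set.abs_sub_left_of_mem_uIcc (Set.uIoc_subset_uIcc hy)
      have := hb (s T) y hy'
      rwa [mul_pow, ← sq_abs (s T), hs, sq_abs, ← mul_pow] at this
  have v1 := vert (fun T => -T) (fun T => abs_neg T)
  have v2 := vert (fun T => T) (fun T => rfl)
  have h3 : Tendsto (fun T : ℝ => (∫ ξ : ℝ in -T..T, F ξ)
      - (∫ ξ : ℝ in -T..T, F (ξ + l * Complex.I))) atTop (nhds 0) := by
    simp_rw [key]
    simpa using v1.sub v2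
  have := tendsto_nhds_unique (t2.sub t1) h3
  exact sub_eq_zero.mp this

lemma norm_exp_sub_one_le' (w : ℂ) : ‖Complex.exp w - 1‖ ≤ ‖w‖ * Real.exp ‖w‖ := by
  have h := Complex.norm_exp_sub_sum_le_norm_mul_exp w 1
  simpa using h

lemma norm_sin_le' (w : ℂ) : ‖Complex.sin w‖ ≤ ‖w‖ * Real.exp ‖w‖ := by
  have e : Complex.sin w = ((Complex.exp (-w * Complex.I) - 1) - (Complex.exp (w * Complex.I) - 1))
      * Complex.I / 2 := by
    rw [Complex.sin]; ring
  rw [e, norm_div, norm_mul, Complex.norm_I]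
  have h1 := norm_exp_sub_one_le' (-w * Complex.I)
  have h2 := norm_exp_sub_one_le' (w * Complex.I)
  simp only [norm_mul, norm_neg, Complex.norm_I, mul_one] at h1 h2
  have h3 := norm_sub_le (Complex.exp (-w * Complex.I) - 1) (Complex.exp (w * Complex.I) - 1)
  simp only [mul_one, Complex.norm_ofNat]
  linarith

lemma norm_one_sub_cos_le (w : ℂ) : ‖1 - Complex.cos w‖ ≤ ‖w‖ ^ 2 * Real.exp ‖w‖ := by
  have e : 1 - Complex.cos w = 2 * Complex.sin (w / 2) ^ 2 := by
    have := Complex.cos_two_mul (w / 2)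
    rw [show 2 * (w / 2) = w by ring] at this
    rw [this]
    linear_combination (-2) * Complex.sin_sq_add_cos_sq (w/2)
  rw [e, norm_mul, norm_pow]
  have h := norm_sin_le' (w / 2)
  have : ‖w / 2‖ = ‖w‖ / 2 := by simp
  rw [this] at h
  have e2 : Real.exp ‖w‖ = Real.exp (‖w‖/2) ^ 2 := by
    rw [← Real.exp_nat_mul]; congr 1; push_cast; ring
  rw [e2]
  have h4 : ‖Complex.sin (w / 2)‖ ^ 2 ≤ (‖w‖ / 2 * Real.exp (‖w‖ / 2)) ^ 2 := by gcongr
  simp only [Complex.norm_ofNat]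
  nlinarith [sq_nonneg (‖w‖ * Real.exp (‖w‖ / 2))]

lemma cosh_sub_one_le (z : ℝ) : Real.cosh z - 1 ≤ z ^ 2 * Real.exp |z| := by
  have h := norm_one_sub_cos_le (z * Complex.I)
  rw [Complex.cos_mul_I] at h
  have h2 : ‖(1 : ℂ) - Complex.cosh z‖ = |1 - Real.cosh z| := by
    rw [← Complex.ofReal_cosh, ← Complex.ofReal_one, ← Complex.ofReal_sub, Complex.norm_real,
      Real.norm_eq_abs]
  rw [h2] at h
  simp only [norm_mul, Complex.norm_I, mul_one, Complex.norm_real, Real.norm_eq_abs, sq_abs] at h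
  have := neg_abs_le (1 - Real.cosh z)
  linarith

noncomputable def PhiC (m : ℝ → ℝ) (z : ℂ) : ℂ := ∫ y : ℝ, (1 - Complex.cos (z * y)) * (m y : ℂ)
noncomputable def PhiR (m : ℝ → ℝ) (ξ : ℝ) : ℝ := ∫ y : ℝ, (1 - Real.cos (ξ * y)) * m y
noncomputable def IF (A : ℝ → ℂ) (x : ℝ) : ℂ := ∫ ξ : ℝ, Complex.exp (Complex.I * x * ξ) * A ξ

structure GoodM (m : ℝ → ℝ) (ρ : ℝ) : Prop where
  meas : Measurable m
  nonneg : ∀ y, 0 ≤ m y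
  supp : ∀ y, ρ < |y| → m y = 0
  int : Integrable (fun y => y ^ 2 * m y)

lemma phiC_ofReal (m : ℝ → ℝ) (ξ : ℝ) : PhiC m ξ = (PhiR m ξ : ℂ) := by
  unfold PhiC PhiR
  rw [← integral_complex_ofReal]
  congr 1; ext y; push_cast; rfl

lemma GoodM.bound {m : ℝ → ℝ} {ρ : ℝ} (hm : GoodM m ρ) (z : ℂ) (y : ℝ) :
    ‖(1 - Complex.cos (z * y)) * (m y : ℂ)‖ ≤ (‖z‖ ^ 2 * Real.exp (‖z‖ * |ρ|)) * (y ^ 2 * m y) := by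
  rcases lt_or_ge ρ |y| with h | h
  · simp [hm.supp y h]
  rw [norm_mul, Complex.norm_real, Real.norm_eq_abs, abs_of_nonneg (hm.nonneg y)]
  have h1 := norm_one_sub_cos_le (z * y)
  rw [norm_mul, Complex.norm_real, Real.norm_eq_abs, mul_pow, sq_abs] at h1
  have h2 : Real.exp (‖z‖ * |y|) ≤ Real.exp (‖z‖ * |ρ|) := by
    exact Real.exp_le_exp.mpr (mul_le_mul_of_nonneg_left (h.trans (le_abs_self _)) (norm_nonneg _))
  calc _ ≤ (‖z‖ ^ 2 * y ^ 2 * Real.exp (‖z‖ * |y|)) * m y := by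
        gcongr; exact hm.nonneg y
    _ ≤ (‖z‖ ^ 2 * y ^ 2 * Real.exp (‖z‖ * |ρ|)) * m y := by
        gcongr; exact hm.nonneg y
    _ = _ := by ring

lemma GoodM.intC {m : ℝ → ℝ} {ρ : ℝ} (hm : GoodM m ρ) (z : ℂ) :
    Integrable (fun y : ℝ => (1 - Complex.cos (z * y)) * (m y : ℂ)) := by
  refine Integrable.mono' (hm.int.const_mul (‖z‖ ^ 2 * Real.exp (‖z‖ * |ρ|))) ?_
    (Eventually.of_forall (hm.bound z))
  have := hm.meas
  have : Measurable (fun y : ℝ => (1 - Complex.cos (z * y)) * (m y : ℂ)) := by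
    apply Measurable.mul
    · exact Continuous.measurable (by fun_prop)
    · exact Complex.measurable_ofReal.comp hm.meas
  exact this.aestronglyMeasurable

lemma GoodM.intR {m : ℝ → ℝ} {ρ : ℝ} (hm : GoodM m ρ) (ξ : ℝ) :
    Integrable (fun y : ℝ => (1 - Real.cos (ξ * y)) * m y) := by
  have := (hm.intC ξ).re
  refine this.congr (Eventually.of_forall fun y => ?_)
  simp only [RCLike.re_eq_complex_re]
  rw [← Complex.ofReal_mul, ← Complex.ofReal_cos, ← Complex.ofReal_one, ← Complex.ofReal_sub,
    ← Complex.ofReal_mul, Complex.ofReal_re]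

lemma GoodM.diff {m : ℝ → ℝ} {ρ : ℝ} (hm : GoodM m ρ) : Differentiable ℂ (PhiC m) := by
  intro z₀
  refine (hasDerivAt_integral_of_dominated_loc_of_deriv_le (μ := volume)
    (F := fun (z : ℂ) (y : ℝ) => (1 - Complex.cos (z * y)) * (m y : ℂ))
    (F' := fun (z : ℂ) (y : ℝ) => (Complex.sin (z * y) * y) * (m y : ℂ))
    (bound := fun y => ((‖z₀‖ + 1) * Real.exp ((‖z₀‖ + 1) * |ρ|)) * (y ^ 2 * m y))
    (Metric.ball_mem_nhds z₀ one_pos)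
    (Eventually.of_forall fun z => (hm.intC z).aestronglyMeasurable) (hm.intC z₀) ?_
    (Eventually.of_forall ?_) (hm.int.const_mul _) (Eventually.of_forall ?_)).2.differentiableAt
  · have : Measurable (fun y : ℝ => (Complex.sin (z₀ * y) * y) * (m y : ℂ)) := by
      apply Measurable.mul
      · exact Continuous.measurable (by fun_prop)
      · exact Complex.measurable_ofReal.comp hm.meas
    exact this.aestronglyMeasurable
  · intro y z hz
    rcases lt_or_ge ρ |y| with h | h
    · simp [hm.supp y h]
    have hz' : ‖z‖ ≤ ‖z₀‖ + 1 := by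
      have h1 : ‖z - z₀‖ < 1 := by simpa [dist_eq_norm] using hz
      have h2 := norm_sub_norm_le z z₀
      linarith
    rw [norm_mul, norm_mul, Complex.norm_real, Complex.norm_real, Real.norm_eq_abs,
      Real.norm_eq_abs, abs_of_nonneg (hm.nonneg y)]
    have h1 := norm_sin_le' (z * y)
    rw [norm_mul, Complex.norm_real, Real.norm_eq_abs] at h1
    have h2 : Real.exp (‖z‖ * |y|) ≤ Real.exp ((‖z₀‖ + 1) * |ρ|) := by
      exact Real.exp_le_exp.mpr (mul_le_mul hz' (h.trans (le_abs_self _)) (abs_nonneg _) (by positivity))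
    have hm0 := hm.nonneg y
    calc _ ≤ (‖z‖ * |y| * Real.exp (‖z‖ * |y|)) * |y| * m y := by gcongr
      _ ≤ ((‖z₀‖ + 1) * |y| * Real.exp ((‖z₀‖ + 1) * |ρ|)) * |y| * m y := by gcongr
      _ = ((‖z₀‖ + 1) * Real.exp ((‖z₀‖ + 1) * |ρ|)) * (|y| ^ 2 * m y) := by ring
      _ = _ := by rw [sq_abs]
  · intro y z _
    have h1 : HasDerivAt (fun z : ℂ => z * (y : ℂ)) (y : ℂ) z := by
      simpa using (hasDerivAt_id z).mul_const (y : ℂ)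
    have h2 := (h1.ccos.const_sub 1).mul_const (m y : ℂ)
    exact h2.congr_deriv (by ring)

lemma GoodM.phiR_nonneg {m : ℝ → ℝ} {ρ : ℝ} (hm : GoodM m ρ) (ξ : ℝ) : 0 ≤ PhiR m ξ :=
  integral_nonneg fun y => mul_nonneg (by linarith [Real.cos_le_one (ξ * y)]) (hm.nonneg y)

lemma GoodM.contR {m : ℝ → ℝ} {ρ : ℝ} (hm : GoodM m ρ) : Continuous (PhiR m) := by
  have : PhiR m = fun ξ : ℝ => (PhiC m ξ).re := by
    ext ξ; rw [phiC_ofReal, Complex.ofReal_re]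
  rw [this]
  exact Complex.continuous_re.comp (hm.diff.continuous.comp Complex.continuous_ofReal)

lemma GoodM.re_lower {m : ℝ → ℝ} {ρ : ℝ} (hm : GoodM m ρ) (hρ : 0 ≤ ρ) (ξ l : ℝ) :
    PhiR m ξ - l ^ 2 * Real.exp (|l| * ρ) * (∫ y, y ^ 2 * m y)
      ≤ (PhiC m (ξ + l * Complex.I)).re := by
  unfold PhiC PhiR
  have e : (∫ y : ℝ, (1 - Complex.cos ((ξ + l * Complex.I) * y)) * (m y : ℂ)).re
      = ∫ y : ℝ, ((1 - Complex.cos ((ξ + l * Complex.I) * y)) * (m y : ℂ)).re := by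
    have := (integral_re (hm.intC (ξ + l * Complex.I))).symm
    simpa using this
  rw [e, ← integral_const_mul, ← integral_sub (hm.intR ξ) (hm.int.const_mul _)]
  apply integral_mono ((hm.intR ξ).sub (hm.int.const_mul _)) (by simpa using (hm.intC (ξ + l * Complex.I)).re)
  intro y
  simp only [Pi.sub_apply]
  rcases lt_or_ge ρ |y| with h | h
  · simp [hm.supp y h]
  have e2 : ((1 - Complex.cos ((ξ + l * Complex.I) * y)) * (m y : ℂ)).re
      = (1 - Real.cos (ξ * y) * Real.cosh (l * y)) * m y := by
    rw [Complex.re_mul_ofReal]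
    congr 1
    rw [show ((ξ:ℂ) + l * Complex.I) * y = ((ξ * y : ℝ) : ℂ) + ((l * y : ℝ) : ℂ) * Complex.I by
      push_cast; ring, Complex.cos_add_mul_I, ← Complex.ofReal_cos, ← Complex.ofReal_cosh,
      ← Complex.ofReal_sin, ← Complex.ofReal_sinh]
    simp only [Complex.sub_re, Complex.one_re, Complex.ofReal_re, Complex.mul_re, Complex.I_re,
      Complex.I_im, Complex.ofReal_im, Complex.mul_im]
    ring
  rw [e2]
  have h1 := cosh_sub_one_le (l * y)
  have h2 : Real.exp |l * y| ≤ Real.exp (|l| * ρ) := by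
    rw [abs_mul]; gcongr
  have h3 : Real.cosh (l * y) - 1 ≤ l ^ 2 * y ^ 2 * Real.exp (|l| * ρ) := by
    calc _ ≤ (l * y) ^ 2 * Real.exp |l * y| := h1
      _ ≤ (l * y) ^ 2 * Real.exp (|l| * ρ) := by gcongr
      _ = _ := by ring
  have h4 : 0 ≤ (1 - Real.cos (ξ * y)) * (Real.cosh (l * y) - 1) :=
    mul_nonneg (by linarith [Real.cos_le_one (ξ * y)]) (by linarith [Real.one_le_cosh (l * y)])
  have hm0 := hm.nonneg y
  have : (1 - Real.cos (ξ * y)) - l ^ 2 * y ^ 2 * Real.exp (|l| * ρ)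
      ≤ 1 - Real.cos (ξ * y) * Real.cosh (l * y) := by nlinarith
  have := mul_le_mul_of_nonneg_right this hm0
  linarith

/-- polynomial bound. -/
lemma poly_bd {R l ξ : ℝ} (hR : 0 < R) (hl : 0 ≤ l) {k : ℕ} (hk : k ≤ 2) :
    (|ξ| + l) ^ k * ((1 + (ξ * R) ^ 2) ^ 2)⁻¹ ≤ 2 * (R⁻¹ + l) ^ k * (1 + (ξ * R) ^ 2)⁻¹ := by
  set s := |ξ| * R with hs
  have hs0 : 0 ≤ s := by positivity
  have e1 : (ξ * R) ^ 2 = s ^ 2 := by rw [hs, mul_pow, mul_pow, sq_abs]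
  rw [e1]
  have h1 : |ξ| + l ≤ (R⁻¹ + l) * (1 + s) := by
    have : R⁻¹ * s = |ξ| := by rw [hs]; field_simp
    have h2 : 0 ≤ l * s := by positivity
    have h3 : 0 ≤ R⁻¹ := by positivity
    nlinarith
  have h2 : (1 + s) ^ k ≤ 2 * (1 + s ^ 2) := by
    calc (1 + s) ^ k ≤ (1 + s) ^ 2 := pow_le_pow_right₀ (by linarith) hk
      _ ≤ _ := by nlinarith [sq_nonneg (1 - s)]
  have h3 : (|ξ| + l) ^ k ≤ (R⁻¹ + l) ^ k * (2 * (1 + s ^ 2)) := by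
    calc _ ≤ ((R⁻¹ + l) * (1 + s)) ^ k := by gcongr
      _ = (R⁻¹ + l) ^ k * (1 + s) ^ k := mul_pow _ _ _
      _ ≤ _ := by gcongr
  calc _ ≤ ((R⁻¹ + l) ^ k * (2 * (1 + s ^ 2))) * ((1 + s ^ 2) ^ 2)⁻¹ := by gcongr
    _ = _ := by field_simp

lemma shift_bound {m : ℝ → ℝ} {ρ t R D l : ℝ} (hm : GoodM m ρ) (hρ : 0 ≤ ρ) (ht : 0 < t)
    (hR : 0 < R) (hD : ∀ ξ, Real.exp (-t * PhiR m ξ) ≤ D * ((1 + (ξ * R) ^ 2) ^ 2)⁻¹)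
    (hl : 0 ≤ l) {k : ℕ} (hk : k ≤ 2) (x : ℝ) :
    ‖IF (fun ξ => (Complex.I * ξ) ^ k * (Real.exp (-t * PhiR m ξ) : ℂ)) x‖
      ≤ 2 * Real.pi * D * R⁻¹ * (R⁻¹ + l) ^ k
        * Real.exp (-l * |x| + t * (l ^ 2 * Real.exp (l * ρ) * (∫ y, y ^ 2 * m y))) := by
  have hV : 0 ≤ ∫ y, y ^ 2 * m y := integral_nonneg fun y => mul_nonneg (sq_nonneg _) (hm.nonneg y)
  set V := ∫ y, y ^ 2 * m y with hVdef
  set F : ℂ → ℂ := fun z => Complex.exp (Complex.I * x * z) *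
    ((Complex.I * z) ^ k * Complex.exp (-t * PhiC m z)) with hFdef
  have hF : Differentiable ℂ F := by
    have := hm.diff
    fun_prop
  have hD0 : 0 ≤ D := by
    have h1 := (Real.exp_pos _).le.trans (hD 0)
    simpa using h1
  -- pointwise bound
  have hn : ∀ ξ y : ℝ, |y| ≤ l → ‖F (ξ + y * Complex.I)‖ ≤
      (2 * D * (R⁻¹ + l) ^ k * Real.exp (-(x * y) + t * (l ^ 2 * Real.exp (l * ρ) * V)))
        * (1 + (ξ * R) ^ 2)⁻¹ := by
    intro ξ y hy
    rw [hFdef]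
    simp only [norm_mul, norm_pow, Complex.norm_exp, Complex.norm_I, one_mul]
    have e1 : (Complex.I * x * (ξ + y * Complex.I)).re = -(x * y) := by simp
    have e2 : (-(t:ℂ) * PhiC m (ξ + y * Complex.I)).re = -t * (PhiC m (ξ + y * Complex.I)).re := by
      simp
    rw [e1, e2]
    have h1 := hm.re_lower hρ ξ y
    have h2 : y ^ 2 * Real.exp (|y| * ρ) * V ≤ l ^ 2 * Real.exp (l * ρ) * V := by
      have : y ^ 2 ≤ l ^ 2 := by rw [← sq_abs y]; gcongr
      gcongr
    have h3 : Real.exp (-t * (PhiC m (ξ + y * Complex.I)).re) ≤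
        Real.exp (-t * PhiR m ξ) * Real.exp (t * (l ^ 2 * Real.exp (l * ρ) * V)) := by
      rw [← Real.exp_add]
      apply Real.exp_le_exp.mpr
      nlinarith
    have h4 : ‖(ξ:ℂ) + y * Complex.I‖ ≤ |ξ| + l := by
      refine (norm_add_le _ _).trans ?_
      simp only [norm_mul, Complex.norm_real, Real.norm_eq_abs, Complex.norm_I, mul_one]
      linarith
    have h5 := poly_bd (ξ := ξ) hR hl hk
    calc _ ≤ Real.exp (-(x * y)) * ((|ξ| + l) ^ k *
          ((D * ((1 + (ξ * R) ^ 2) ^ 2)⁻¹) * Real.exp (t * (l ^ 2 * Real.exp (l * ρ) * V)))) := by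
          gcongr
          exact h3.trans (by gcongr; exact hD ξ)
      _ = (Real.exp (-(x * y)) * D * Real.exp (t * (l ^ 2 * Real.exp (l * ρ) * V))) *
          ((|ξ| + l) ^ k * ((1 + (ξ * R) ^ 2) ^ 2)⁻¹) := by ring
      _ ≤ (Real.exp (-(x * y)) * D * Real.exp (t * (l ^ 2 * Real.exp (l * ρ) * V))) *
          (2 * (R⁻¹ + l) ^ k * (1 + (ξ * R) ^ 2)⁻¹) := by gcongr
      _ = _ := by rw [Real.exp_add]; ring
  obtain ⟨l', hl', hxl⟩ : ∃ l' : ℝ, |l'| = l ∧ x * l' = l * |x| := by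
    rcases le_total 0 x with h | h
    · exact ⟨l, abs_of_nonneg hl, by rw [abs_of_nonneg h]; ring⟩
    · exact ⟨-l, by rw [abs_neg, abs_of_nonneg hl], by rw [abs_of_nonpos h]; ring⟩
  have e0 : IF (fun ξ => (Complex.I * ξ) ^ k * (Real.exp (-t * PhiR m ξ) : ℂ)) x
      = ∫ ξ : ℝ, F ξ := by
    unfold IF
    congr 1; ext ξ
    rw [hFdef]
    simp only
    rw [phiC_ofReal]
    push_cast
    rfl
  rw [e0, contour F hF (l := l') (R := R)
    (K := 2 * D * (R⁻¹ + l) ^ k * Real.exp (|x| * l + t * (l ^ 2 * Real.exp (l * ρ) * V))) hR]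
  · refine (norm_integral_le_of_norm_le ((int_bd hR).const_mul _)
      (Eventually.of_forall fun ξ => hn ξ l' hl'.le)).trans ?_
    rw [integral_const_mul, integral_bd hR, hxl]
    apply le_of_eq
    rw [show -(l * |x|) = -l * |x| by ring]
    field_simp
  · intro ξ y hy
    rw [hl'] at hy
    refine (hn ξ y hy).trans ?_
    gcongr
    calc -(x * y) ≤ |x * y| := neg_le_abs _
      _ = |x| * |y| := abs_mul _ _
      _ ≤ |x| * l := by gcongr

noncomputable def chat (σ : ℝ → ℝ) (ξ : ℝ) : ℝ := ∫ y : ℝ, Real.cos (ξ * y) * σ y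

lemma chat_int {σ : ℝ → ℝ} (hσ : Integrable σ) (ξ : ℝ) :
    Integrable (fun y => Real.cos (ξ * y) * σ y) := by
  refine hσ.bdd_mul (c := 1) (Continuous.aestronglyMeasurable (by fun_prop)) (Eventually.of_forall fun y => ?_)
  rw [Real.norm_eq_abs]; exact Real.abs_cos_le_one _

lemma chat_cont {σ : ℝ → ℝ} (hσ : Integrable σ) : Continuous (chat σ) := by
  refine continuous_of_dominated (bound := fun y => ‖σ y‖) (fun ξ => (chat_int hσ ξ).aestronglyMeasurable)
    (fun ξ => Eventually.of_forall fun y => ?_) hσ.norm (Eventually.of_forall fun y => by fun_prop)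
  rw [norm_mul, Real.norm_eq_abs]
  exact mul_le_of_le_one_left (norm_nonneg _) (Real.abs_cos_le_one _)

lemma chat_le {σ : ℝ → ℝ} (hσ : Integrable σ) (h0 : ∀ y, 0 ≤ σ y) (ξ : ℝ) :
    |chat σ ξ| ≤ ∫ y, σ y := by
  rw [← Real.norm_eq_abs]
  refine norm_integral_le_of_norm_le hσ (Eventually.of_forall fun y => ?_)
  rw [norm_mul, Real.norm_eq_abs, Real.norm_eq_abs, abs_of_nonneg (h0 y)]
  exact mul_le_of_le_one_left (h0 y) (Real.abs_cos_le_one _)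

lemma IF_int {A : ℝ → ℂ} (hA : Integrable A) (x : ℝ) :
    Integrable (fun ξ : ℝ => Complex.exp (Complex.I * x * ξ) * A ξ) := by
  refine hA.bdd_mul (c := 1) (Continuous.aestronglyMeasurable (by fun_prop)) (Eventually.of_forall fun y => ?_)
  rw [Complex.norm_exp]
  simp

lemma IF_cont {A : ℝ → ℂ} (hA : Integrable A) : Continuous (IF A) := by
  refine continuous_of_dominated (bound := fun y => ‖A y‖) (fun ξ => (IF_int hA ξ).aestronglyMeasurable)
    (fun ξ => Eventually.of_forall fun y => ?_) hA.norm (Eventually.of_forall fun y => by fun_prop)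
  rw [norm_mul, Complex.norm_exp]
  simp

lemma IF_cos {A : ℝ → ℂ} (hA : Integrable A) {σ : ℝ → ℝ} (hσ : Integrable σ) (x : ℝ) :
    IF (fun ξ => A ξ * (chat σ ξ : ℂ)) x
      = ∫ y : ℝ, (σ y : ℂ) * ((1/2) * (IF A (x + y) + IF A (x - y))) := by
  have hprod : Integrable (fun p : ℝ × ℝ => Complex.exp (Complex.I * x * p.1) *
      (A p.1 * (((Real.cos (p.1 * p.2) : ℝ) : ℂ) * (σ p.2 : ℂ)))) (volume.prod volume) := by
    have h1 : Integrable (fun p : ℝ × ℝ => A p.1 * (σ p.2 : ℂ)) (volume.prod volume) :=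
      hA.mul_prod hσ.ofReal
    have h2 := h1.bdd_mul (c := 1) (f := fun p : ℝ × ℝ => Complex.exp (Complex.I * x * p.1) *
      ((Real.cos (p.1 * p.2) : ℝ) : ℂ)) (Continuous.aestronglyMeasurable (by fun_prop))
      (Eventually.of_forall fun p => by
        rw [norm_mul, Complex.norm_exp, Complex.norm_real, Real.norm_eq_abs]
        simpa using Real.abs_cos_le_one _)
    refine h2.congr (Eventually.of_forall fun p => ?_)
    simp only
    ring
  have hs := integral_integral_swap (f := fun ξ y : ℝ => Complex.exp (Complex.I * x * ξ) *
      (A ξ * (((Real.cos (ξ * y) : ℝ) : ℂ) * (σ y : ℂ)))) hprod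
  unfold IF
  have e1 : ∀ ξ : ℝ, Complex.exp (Complex.I * x * ξ) * (A ξ * (chat σ ξ : ℂ))
      = ∫ y : ℝ, Complex.exp (Complex.I * x * ξ) *
      (A ξ * (((Real.cos (ξ * y) : ℝ) : ℂ) * (σ y : ℂ))) := by
    intro ξ
    rw [integral_const_mul, integral_const_mul]
    congr 2
    unfold chat
    rw [← integral_complex_ofReal]
    congr 1; ext y; push_cast; rfl
  simp_rw [e1]
  rw [hs]
  congr 1; ext y
  rw [← integral_add (IF_int hA _) (IF_int hA _), ← integral_const_mul, ← integral_const_mul]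
  congr 1; ext ξ
  push_cast
  rw [Complex.cos, show Complex.I * ((x:ℂ) + y) * ξ = Complex.I * x * ξ + ξ * y * Complex.I by ring,
    show Complex.I * ((x:ℂ) - y) * ξ = Complex.I * x * ξ + -(ξ * y) * Complex.I by ring,
    Complex.exp_add, Complex.exp_add]
  ring

lemma IF_cos_bd {A : ℝ → ℂ} (hA : Integrable A) {σ : ℝ → ℝ} (hσ : Integrable σ)
    (h0 : ∀ y, 0 ≤ σ y) {M : ℝ} (hM : ∀ x, ‖IF A x‖ ≤ M) (x : ℝ) :
    ‖IF (fun ξ => A ξ * (chat σ ξ : ℂ)) x‖ ≤ M * ∫ y, σ y := by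
  rw [IF_cos hA hσ, ← integral_const_mul]
  refine norm_integral_le_of_norm_le (hσ.const_mul M) (Eventually.of_forall fun y => ?_)
  have := norm_add_le (IF A (x + y)) (IF A (x - y))
  rw [norm_mul, norm_mul, Complex.norm_real, Real.norm_eq_abs, abs_of_nonneg (h0 y), mul_comm]
  have h1 := hM (x + y)
  have h2 := hM (x - y)
  have : ‖(1/2 : ℂ)‖ = 1/2 := by simp
  rw [this]
  exact mul_le_mul_of_nonneg_right (by linarith) (h0 y)

lemma IF_cos_bd' {A : ℝ → ℂ} (hA : Integrable A) {σ : ℝ → ℝ} (hσ : Integrable σ)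
    (h0 : ∀ y, 0 ≤ σ y) {S : ℝ} (hS : ∀ y, σ y ≤ S) {B : ℝ → ℝ} (hB : Integrable B)
    (hM : ∀ x, ‖IF A x‖ ≤ B x) (x : ℝ) :
    ‖IF (fun ξ => A ξ * (chat σ ξ : ℂ)) x‖ ≤ S * ∫ y, B y := by
  rw [IF_cos hA hσ]
  have i1 : Integrable (fun y => B (x + y)) := hB.comp_add_left x
  have i2 : Integrable (fun y => B (x - y)) := hB.comp_sub_left x
  have e : S * ∫ y, B y = ∫ y, S * ((1/2) * (B (x + y) + B (x - y))) := by
    rw [integral_const_mul, integral_const_mul, integral_add i1 i2,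
      integral_add_left_eq_self (fun y => B y) x, integral_sub_left_eq_self (fun y => B y) volume x]
    ring
  rw [e]
  refine norm_integral_le_of_norm_le (((i1.add i2).const_mul _).const_mul S)
    (Eventually.of_forall fun y => ?_)
  have := norm_add_le (IF A (x + y)) (IF A (x - y))
  rw [norm_mul, norm_mul, Complex.norm_real, Real.norm_eq_abs, abs_of_nonneg (h0 y)]
  have h1 := hM (x + y)
  have h2 := hM (x - y)
  have h3 : ‖(1/2 : ℂ)‖ = 1/2 := by simp
  rw [h3]
  refine mul_le_mul (hS y) (by linarith) (by positivity) ((h0 y).trans (hS y))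

lemma int_mul_chat {A : ℝ → ℂ} (hA : Integrable A) {f : ℝ → ℝ} (hf : Continuous f) {C : ℝ}
    (hC : ∀ ξ, |f ξ| ≤ C) :
    Integrable (fun ξ => A ξ * (f ξ : ℂ)) := by
  have : Integrable (fun ξ => (f ξ : ℂ) * A ξ) := by
    refine hA.bdd_mul (c := C) (Continuous.aestronglyMeasurable (by fun_prop)) (Eventually.of_forall fun y => ?_)
    rw [Complex.norm_real, Real.norm_eq_abs]; exact hC y
  exact this.congr (Eventually.of_forall fun ξ => mul_comm _ _)

lemma IF_pow_bd {A : ℝ → ℂ} (hA : Integrable A) {σ : ℝ → ℝ} (hσ : Integrable σ)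
    (h0 : ∀ y, 0 ≤ σ y) {M : ℝ} (hM : ∀ x, ‖IF A x‖ ≤ M) (n : ℕ) :
    Integrable (fun ξ => A ξ * ((chat σ ξ ^ n : ℝ) : ℂ)) ∧
    ∀ x, ‖IF (fun ξ => A ξ * ((chat σ ξ ^ n : ℝ) : ℂ)) x‖ ≤ M * (∫ y, σ y) ^ n := by
  induction n with
  | zero => simpa using ⟨hA, hM⟩
  | succ n ih =>
    have e : (fun ξ => A ξ * ((chat σ ξ ^ (n+1) : ℝ) : ℂ)) =
        fun ξ => (A ξ * ((chat σ ξ ^ n : ℝ) : ℂ)) * (chat σ ξ : ℂ) := by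
      ext ξ; push_cast; ring
    rw [e]
    refine ⟨int_mul_chat ih.1 (chat_cont hσ) (chat_le hσ h0), fun x => ?_⟩
    refine (IF_cos_bd ih.1 hσ h0 ih.2 x).trans (le_of_eq (by ring))

lemma IF_series {A : ℝ → ℂ} (hA : Integrable A) {σ : ℝ → ℝ} (hσ : Integrable σ)
    (h0 : ∀ y, 0 ≤ σ y) {M : ℝ} (hM : ∀ x, ‖IF A x‖ ≤ M) {a : ℕ → ℝ} (ha : ∀ n, 0 ≤ a n)
    {f : ℝ → ℝ} (hf : ∀ z, HasSum (fun n => a n * z ^ n) (f z)) (x : ℝ) :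
    ‖IF (fun ξ => A ξ * (f (chat σ ξ) : ℂ)) x‖ ≤ M * f (∫ y, σ y) := by
  set s := ∫ y, σ y with hs
  have hs0 : 0 ≤ s := integral_nonneg h0
  have hp := IF_pow_bd hA hσ h0 hM
  set F : ℕ → ℝ → ℂ := fun n ξ => (a n : ℂ) * (Complex.exp (Complex.I * x * ξ) *
    (A ξ * ((chat σ ξ ^ n : ℝ) : ℂ))) with hF
  have hFi : ∀ n, Integrable (F n) := fun n => (IF_int (hp n).1 x).const_mul _
  have hFn : ∀ n, ∫ ξ, ‖F n ξ‖ ≤ (a n * s ^ n) * ∫ ξ, ‖A ξ‖ := by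
    intro n
    rw [← integral_const_mul]
    refine integral_mono (hFi n).norm (hA.norm.const_mul _) fun ξ => ?_
    simp only [hF]
    rw [norm_mul, norm_mul, norm_mul, Complex.norm_real, Complex.norm_real, Complex.norm_exp,
      Real.norm_eq_abs, Real.norm_eq_abs, abs_of_nonneg (ha n), abs_pow]
    have h1 : |chat σ ξ| ^ n ≤ s ^ n := by gcongr; exact chat_le hσ h0 ξ
    have h2 : Real.exp ((Complex.I * x * ξ).re) = 1 := by simp
    rw [h2, one_mul]
    have := mul_le_mul_of_nonneg_left h1 (norm_nonneg (A ξ))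
    have := mul_le_mul_of_nonneg_left this (ha n)
    linarith
  have hsum : Summable fun n => ∫ ξ, ‖F n ξ‖ :=
    Summable.of_nonneg_of_le (fun n => integral_nonneg fun _ => norm_nonneg _) hFn
      ((hf s).summable.mul_right _)
  have hS := hasSum_integral_of_summable_integral_norm hFi hsum
  have e1 : (∫ ξ, ∑' n, F n ξ) = IF (fun ξ => A ξ * (f (chat σ ξ) : ℂ)) x := by
    unfold IF
    congr 1; ext ξ
    have h1 := (Complex.hasSum_ofReal.mpr (hf (chat σ ξ))).mul_left
      (Complex.exp (Complex.I * x * ξ) * A ξ)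
    have h2 : HasSum (fun n => F n ξ) (Complex.exp (Complex.I * x * ξ) * (A ξ * (f (chat σ ξ) : ℂ))) := by
      have q1 : (fun n => F n ξ) = fun n => Complex.exp (Complex.I * x * ξ) * A ξ *
          ((a n * chat σ ξ ^ n : ℝ) : ℂ) := by
        ext n; simp only [hF]; push_cast; ring
      rw [q1, ← mul_assoc]
      exact h1
    exact h2.tsum_eq
  rw [e1] at hS
  have hB : ∀ n, ‖∫ ξ, F n ξ‖ ≤ M * (a n * s ^ n) := by
    intro n
    simp only [hF]
    rw [integral_const_mul, norm_mul, Complex.norm_real, Real.norm_eq_abs, abs_of_nonneg (ha n)]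
    have := mul_le_mul_of_nonneg_left ((hp n).2 x) (ha n)
    unfold IF at this
    linarith
  have h3 := tsum_of_norm_bounded ((hf s).mul_left M) hB
  rwa [hS.tsum_eq] at h3

noncomputable def expm (z : ℝ) : ℝ := if z = 0 then 1 else (Real.exp z - 1) / z

lemma expm_mul (z : ℝ) : z * expm z = Real.exp z - 1 := by
  unfold expm; split_ifs with h
  · simp [h]
  · field_simp

lemma exp_hasSum (z : ℝ) : HasSum (fun n : ℕ => ((n.factorial : ℝ)⁻¹) * z ^ n) (Real.exp z) := by
  have := NormedSpace.expSeries_div_hasSum_exp z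
  rw [← Real.exp_eq_exp_ℝ] at this
  simp_rw [div_eq_inv_mul] at this
  exact this

lemma expm_hasSum (z : ℝ) : HasSum (fun n : ℕ => (((n+1).factorial : ℝ)⁻¹) * z ^ n) (expm z) := by
  unfold expm; split_ifs with h
  · subst h
    convert hasSum_single (f := fun n : ℕ => (((n+1).factorial : ℝ)⁻¹) * (0:ℝ) ^ n) 0 ?_ using 1
    · simp
    · intro n hn; simp [hn]
  · have h1 := (hasSum_nat_add_iff' 1).mpr (exp_hasSum z)
    have h2 := h1.div_const z
    simp only [Finset.range_one, Finset.sum_singleton, Nat.factorial_zero, pow_zero] at h2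
    have q1 : (fun n : ℕ => (((n+1).factorial : ℝ)⁻¹) * z ^ n) =
        fun n : ℕ => (((n+1).factorial : ℝ)⁻¹) * z ^ (n+1) / z := by
      ext n; rw [pow_succ]; field_simp
    rw [q1]
    simpa using h2

lemma expm_le {z : ℝ} (hz : 0 ≤ z) : expm z ≤ Real.exp z := by
  unfold expm; split_ifs with h
  · simp [h]
  · have hz' : 0 < z := lt_of_le_of_ne hz (Ne.symm h)
    rw [div_le_iff₀ hz']
    have h1 := Real.add_one_le_exp (-z)
    have h2 : Real.exp z * Real.exp (-z) = 1 := by rw [← Real.exp_add]; simp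
    nlinarith [Real.exp_pos z]

lemma bigjump {E : ℝ → ℂ} (hE : Integrable E) {B : ℝ → ℝ} (hB : Integrable B)
    (hEB : ∀ x, ‖IF E x‖ ≤ B x) {σ₁ σ₂ : ℝ → ℝ} (h1 : Integrable σ₁) (h2 : Integrable σ₂)
    (p1 : ∀ y, 0 ≤ σ₁ y) (p2 : ∀ y, 0 ≤ σ₂ y) {S : ℝ} (hS : ∀ y, σ₂ y ≤ S) (x : ℝ) :
    ‖IF (fun ξ => E ξ * ((Real.exp (chat σ₁ ξ) * (Real.exp (chat σ₂ ξ) - 1) : ℝ) : ℂ)) x‖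
      ≤ (S * ∫ y, B y) * Real.exp ((∫ y, σ₁ y) + ∫ y, σ₂ y) := by
  have a1 := IF_cos_bd' hE h2 p2 hS hB hEB
  have i1 := int_mul_chat hE (chat_cont h2) (chat_le h2 p2)
  have a2 := IF_series i1 h1 p1 a1 (a := fun n => ((n.factorial : ℝ)⁻¹)) (fun n => by positivity)
    exp_hasSum
  have i2 : Integrable (fun ξ => (E ξ * (chat σ₂ ξ : ℂ)) * (Real.exp (chat σ₁ ξ) : ℂ)) := by
    refine int_mul_chat i1 (Real.continuous_exp.comp (chat_cont h1)) (C := Real.exp (∫ y, σ₁ y)) ?_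
    intro ξ
    rw [abs_of_pos (Real.exp_pos _)]
    exact Real.exp_le_exp.mpr ((le_abs_self _).trans (chat_le h1 p1 ξ))
  have a3 := IF_series i2 h2 p2 a2 (a := fun n => (((n+1).factorial : ℝ)⁻¹)) (fun n => by positivity)
    expm_hasSum x
  have e : (fun ξ => E ξ * ((Real.exp (chat σ₁ ξ) * (Real.exp (chat σ₂ ξ) - 1) : ℝ) : ℂ))
      = fun ξ => (E ξ * (chat σ₂ ξ : ℂ)) * (Real.exp (chat σ₁ ξ) : ℂ) * (expm (chat σ₂ ξ) : ℂ) := by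
    ext ξ
    rw [← expm_mul]; push_cast; ring
  rw [e]
  refine a3.trans ?_
  rw [Real.exp_add, ← mul_assoc]
  have hM0 : 0 ≤ S * ∫ y, B y := (norm_nonneg _).trans (a1 0)
  refine mul_le_mul_of_nonneg_left (expm_le (integral_nonneg p2)) (by positivity)

structure Ctx (ν μ h : ℝ → ℝ) (α C₁ δ : ℝ) : Prop where
  hα : 0 < α
  hC₁ : 0 < C₁
  hδ : 0 < δ
  νmeas : Measurable ν
  νnonneg : ∀ x, 0 ≤ ν x
  νint : Integrable (fun x : ℝ => min (x ^ 2) 1 * ν x)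
  hdef : ∀ r : ℝ, 0 < r → h r = ∫ x : ℝ, min 1 (x ^ 2 / r ^ 2) * ν x
  hanti : ∀ r s : ℝ, 0 < r → r ≤ s → h s ≤ h r
  hpos : ∀ r : ℝ, 0 < r → 0 < h r
  hlsc : ∀ θ : ℝ, 0 < θ → ∀ l : ℝ, 1 ≤ l → C₁ * l ^ α * h (l * θ) ≤ h θ
  μmeas : Measurable μ
  μeq : ∀ x, x ≠ 0 → |x| ≤ δ → μ x = ν x
  μbd : ∀ x, x ≠ 0 → 0 ≤ μ x ∧ μ x ≤ ν x
  μzero : ∀ x, 2 * δ ≤ |x| → μ x = 0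
  μanti : ∀ x y, x ≠ 0 → |x| ≤ |y| → μ y ≤ μ x

noncomputable def win (μ : ℝ → ℝ) (a b y : ℝ) : ℝ := if a < |y| ∧ |y| ≤ b then μ y else 0

section
variable {ν μ h : ℝ → ℝ} {α C₁ δ : ℝ}

lemma min_bd {r : ℝ} (hr : 0 < r) (x : ℝ) :
    min 1 (x ^ 2 / r ^ 2) ≤ max 1 (1 / r ^ 2) * min (x ^ 2) 1 := by
  rcases le_total (x ^ 2) 1 with h | h
  · rw [min_eq_left h]
    refine (min_le_right _ _).trans ?_
    rw [div_eq_mul_one_div, mul_comm]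
    exact mul_le_mul_of_nonneg_right (le_max_right _ _) (sq_nonneg _)
  · rw [min_eq_right h, mul_one]
    exact (min_le_left _ _).trans (le_max_left _ _)

lemma Ctx.hint (c : Ctx ν μ h α C₁ δ) {r : ℝ} (hr : 0 < r) :
    Integrable (fun x : ℝ => min 1 (x ^ 2 / r ^ 2) * ν x) := by
  refine Integrable.mono' (c.νint.const_mul (max 1 (1 / r ^ 2))) ?_ (Eventually.of_forall fun x => ?_)
  · have := c.νmeas
    exact Measurable.aestronglyMeasurable (by fun_prop)
  · have h0 : 0 ≤ min 1 (x ^ 2 / r ^ 2) := le_min zero_le_one (by positivity)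
    rw [Real.norm_eq_abs, abs_of_nonneg (mul_nonneg h0 (c.νnonneg x)), ← mul_assoc]
    exact mul_le_mul_of_nonneg_right (min_bd hr x) (c.νnonneg x)

lemma Ctx.hscale (c : Ctx ν μ h α C₁ δ) {s r : ℝ} (hs : 0 < s) (hsr : s ≤ r) :
    s ^ 2 * h s ≤ r ^ 2 * h r := by
  have hr := hs.trans_le hsr
  rw [c.hdef s hs, c.hdef r hr, ← integral_const_mul, ← integral_const_mul]
  refine integral_mono ((c.hint hs).const_mul _) ((c.hint hr).const_mul _) fun x => ?_
  simp only
  rw [← mul_assoc, ← mul_assoc]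
  refine mul_le_mul_of_nonneg_right ?_ (c.νnonneg x)
  rw [mul_min_of_nonneg _ _ (sq_nonneg s), mul_min_of_nonneg _ _ (sq_nonneg r)]
  have e1 : s ^ 2 * (x ^ 2 / s ^ 2) = x ^ 2 := by field_simp
  have e2 : r ^ 2 * (x ^ 2 / r ^ 2) = x ^ 2 := by field_simp
  rw [e1, e2]
  have : s ^ 2 ≤ r ^ 2 := by gcongr
  exact min_le_min (by linarith) le_rfl

lemma Ctx.sqint (c : Ctx ν μ h α C₁ δ) {r : ℝ} (hr : 0 < r) :
    Integrable (fun y => if |y| ≤ r then y ^ 2 * ν y else 0) := by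
  refine Integrable.mono' ((c.hint hr).const_mul (r ^ 2)) ?_ (Eventually.of_forall fun x => ?_)
  · have := c.νmeas
    refine Measurable.aestronglyMeasurable (Measurable.ite ?_ (by fun_prop) (by fun_prop))
    exact measurableSet_le (by fun_prop) (by fun_prop)
  · have hm := c.νnonneg x
    have h0 : 0 ≤ min 1 (x ^ 2 / r ^ 2) := le_min zero_le_one (by positivity)
    split_ifs with hx
    · have h1 : x ^ 2 / r ^ 2 ≤ 1 := by
        rw [div_le_one (by positivity), ← sq_abs x]; gcongr
      rw [min_eq_right h1, Real.norm_eq_abs, abs_of_nonneg (by positivity)]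
      apply le_of_eq; field_simp
    · rw [norm_zero]; positivity

lemma Ctx.hK (c : Ctx ν μ h α C₁ δ) : ∃ c₀ : ℝ, 0 < c₀ ∧ ∀ θ : ℝ, 0 < θ →
    c₀ * (θ ^ 2 * h θ) ≤ ∫ y, (if |y| ≤ θ then y ^ 2 * ν y else 0) := by
  have hα := c.hα
  have hC := c.hC₁
  set L := max 1 ((2 / C₁) ^ (1 / α)) with hL
  have hL1 : 1 ≤ L := le_max_left _ _
  have hL0 : 0 < L := by linarith
  have hLα : 2 ≤ C₁ * L ^ α := by
    have h1 : ((2 / C₁) ^ (1 / α)) ^ α ≤ L ^ α :=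
      Real.rpow_le_rpow (by positivity) (le_max_right _ _) hα.le
    rw [← Real.rpow_mul (by positivity), one_div_mul_cancel hα.ne', Real.rpow_one,
      div_le_iff₀ hC] at h1
    linarith
  refine ⟨(L ^ 2)⁻¹, by positivity, fun θ hθ => ?_⟩
  have h1 := c.hlsc (θ / L) (by positivity) L hL1
  rw [mul_div_cancel₀ _ hL0.ne'] at h1
  have hp := c.hpos θ hθ
  have h2 : h θ ≤ h (θ / L) - h θ := by nlinarith
  have h3 : h (θ / L) - h θ ≤ (L ^ 2 / θ ^ 2) * ∫ y, (if |y| ≤ θ then y ^ 2 * ν y else 0) := by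
    have hq : 0 < θ / L := by positivity
    rw [c.hdef _ hq, c.hdef _ hθ, ← integral_sub (c.hint hq) (c.hint hθ), ← integral_const_mul]
    refine integral_mono ((c.hint hq).sub (c.hint hθ)) ((c.sqint hθ).const_mul _) fun y => ?_
    simp only
    rw [← sub_mul]
    have hm := c.νnonneg y
    split_ifs with hy
    · have a1 : min 1 (y ^ 2 / (θ / L) ^ 2) ≤ L ^ 2 / θ ^ 2 * y ^ 2 := by
        refine (min_le_right _ _).trans (le_of_eq ?_)
        field_simp
      have a2 : 0 ≤ min 1 (y ^ 2 / θ ^ 2) := le_min zero_le_one (by positivity)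
      rw [← mul_assoc]
      exact mul_le_mul_of_nonneg_right (by linarith) hm
    · push Not at hy
      have a1 : min 1 (y ^ 2 / θ ^ 2) = 1 := by
        apply min_eq_left
        rw [one_le_div (by positivity), ← sq_abs y]; gcongr
      have a2 : min 1 (y ^ 2 / (θ / L) ^ 2) ≤ 1 := min_le_left _ _
      rw [a1, mul_zero]
      exact mul_nonpos_of_nonpos_of_nonneg (by linarith) hm
  have h4 := h2.trans h3
  set K := ∫ y, (if |y| ≤ θ then y ^ 2 * ν y else 0)
  calc (L ^ 2)⁻¹ * (θ ^ 2 * h θ) ≤ (L ^ 2)⁻¹ * (θ ^ 2 * (L ^ 2 / θ ^ 2 * K)) := by gcongr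
    _ = K := by field_simp

lemma win_nonneg (c : Ctx ν μ h α C₁ δ) {a b : ℝ} (ha : 0 ≤ a) (y : ℝ) : 0 ≤ win μ a b y := by
  unfold win; split_ifs with hy
  · exact (c.μbd y (abs_pos.mp (ha.trans_lt hy.1))).1
  · rfl

lemma win_meas (c : Ctx ν μ h α C₁ δ) (a b : ℝ) : Measurable (win μ a b) := by
  refine Measurable.ite ?_ c.μmeas measurable_const
  have ha : Measurable (fun y : ℝ => |y|) := by fun_prop
  exact (measurableSet_lt measurable_const ha).inter (measurableSet_le ha measurable_const)

lemma win_sq_le (c : Ctx ν μ h α C₁ δ) {b : ℝ} (y : ℝ) :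
    y ^ 2 * win μ 0 b y ≤ if |y| ≤ b then y ^ 2 * ν y else 0 := by
  unfold win
  by_cases hb : |y| ≤ b
  · rw [if_pos hb]
    by_cases hy : 0 < |y|
    · rw [if_pos ⟨hy, hb⟩]
      exact mul_le_mul_of_nonneg_left (c.μbd y (abs_pos.mp hy)).2 (sq_nonneg _)
    · rw [if_neg (fun h => hy h.1)]
      have := c.νnonneg y
      rw [mul_zero]; positivity
  · rw [if_neg (fun h => hb h.2), if_neg hb, mul_zero]

lemma win_good (c : Ctx ν μ h α C₁ δ) {b : ℝ} (hb : 0 < b) : GoodM (win μ 0 b) b := by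
  refine ⟨win_meas c 0 b, win_nonneg c le_rfl, fun y hy => ?_, ?_⟩
  · unfold win; rw [if_neg]; intro h; linarith [h.2]
  · refine Integrable.mono' (c.sqint hb) ?_ (Eventually.of_forall fun y => ?_)
    · have := win_meas c 0 b
      exact Measurable.aestronglyMeasurable (by fun_prop)
    · rw [Real.norm_eq_abs, abs_of_nonneg (mul_nonneg (sq_nonneg _) (win_nonneg c le_rfl y))]
      exact win_sq_le c y

lemma win_V (c : Ctx ν μ h α C₁ δ) {b : ℝ} (hb : 0 < b) : ∫ y, y ^ 2 * win μ 0 b y ≤ b ^ 2 * h b := by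
  refine (integral_mono (win_good c hb).int (c.sqint hb) (win_sq_le c)).trans ?_
  rw [c.hdef b hb, ← integral_const_mul]
  refine integral_mono (c.sqint hb) ((c.hint hb).const_mul _) fun y => ?_
  have hm := c.νnonneg y
  simp only
  split_ifs with hy
  · have h1 : y ^ 2 / b ^ 2 ≤ 1 := by
      rw [div_le_one (by positivity), ← sq_abs y]; gcongr
    rw [min_eq_right h1]
    apply le_of_eq; field_simp
  · have h0 : 0 ≤ min 1 (y ^ 2 / b ^ 2) := le_min zero_le_one (by positivity)
    positivity

lemma win_int (c : Ctx ν μ h α C₁ δ) {a : ℝ} (ha : 0 < a) (b : ℝ) : Integrable (win μ a b) := by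
  refine Integrable.mono' (c.hint ha) (win_meas c a b).aestronglyMeasurable
    (Eventually.of_forall fun y => ?_)
  rw [Real.norm_eq_abs, abs_of_nonneg (win_nonneg c ha.le y)]
  have hm := c.νnonneg y
  unfold win; split_ifs with hy
  · have : min 1 (y ^ 2 / a ^ 2) = 1 := by
      apply min_eq_left
      rw [one_le_div (by positivity), ← sq_abs y]; gcongr; exact hy.1.le
    rw [this, one_mul]
    exact (c.μbd y (abs_pos.mp (ha.trans hy.1))).2
  · have h0 : 0 ≤ min 1 (y ^ 2 / a ^ 2) := le_min zero_le_one (by positivity)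
    positivity

lemma phi_add (c : Ctx ν μ h α C₁ δ) {a b : ℝ} (ha : 0 < a) (hab : a ≤ b) (ξ : ℝ) :
    PhiR (win μ 0 b) ξ = PhiR (win μ 0 a) ξ + ((∫ y, win μ a b y) - chat (win μ a b) ξ) := by
  unfold PhiR chat
  have hI : Integrable (fun y => win μ a b y - Real.cos (ξ * y) * win μ a b y) :=
    (win_int c ha b).sub (chat_int (win_int c ha b) ξ)
  rw [← integral_sub (win_int c ha b) (chat_int (win_int c ha b) ξ), ← integral_add
    ((win_good c ha).intR ξ) hI]
  congr 1; ext y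
  have : win μ 0 b y = win μ 0 a y + win μ a b y := by
    unfold win
    by_cases h1 : 0 < |y|
    · by_cases h2 : |y| ≤ a
      · rw [if_pos ⟨h1, h2.trans hab⟩, if_pos ⟨h1, h2⟩, if_neg (fun h => by linarith [h.1]), add_zero]
      · push Not at h2
        by_cases h3 : |y| ≤ b
        · rw [if_pos ⟨h1, h3⟩, if_neg (fun h => by linarith [h.2]), if_pos ⟨h2, h3⟩, zero_add]
        · rw [if_neg (fun h => h3 h.2), if_neg (fun h => by linarith [h.2]), if_neg (fun h => h3 h.2), add_zero]
    · rw [if_neg (fun h => h1 h.1), if_neg (fun h => h1 h.1), if_neg (fun h => h1 (ha.trans h.1)), add_zero]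
  rw [this]; ring

lemma phi_lower (c : Ctx ν μ h α C₁ δ) : ∃ c₀ : ℝ, 0 < c₀ ∧ ∀ R b ξ : ℝ, 0 < R → R ≤ δ → R ≤ b →
    1 ≤ |ξ| * R → c₀ * (|ξ| * R) ^ α * h R ≤ PhiR (win μ 0 b) ξ := by
  obtain ⟨k, hk, hK⟩ := c.hK
  have hC := c.hC₁
  refine ⟨2 / Real.pi ^ 2 * k * C₁, by positivity, fun R b ξ hR hRδ hRb hξ => ?_⟩
  have hξ0 : 0 < |ξ| := by
    by_contra hh
    have : |ξ| = 0 := le_antisymm (not_lt.mp hh) (abs_nonneg _)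
    rw [this] at hξ; linarith
  set θ := |ξ|⁻¹ with hθ
  have hθ0 : 0 < θ := by positivity
  have hθR : θ ≤ R := by
    rw [hθ, inv_le_iff_one_le_mul₀' hξ0]; exact hξ
  have h1 := hK θ hθ0
  have h2 := c.hlsc θ hθ0 (|ξ| * R) hξ
  have e : |ξ| * R * θ = R := by rw [hθ]; field_simp
  rw [e] at h2
  have h3 : 2 / Real.pi ^ 2 * (ξ ^ 2 * ∫ y, (if |y| ≤ θ then y ^ 2 * ν y else 0)) ≤
      PhiR (win μ 0 b) ξ := by
    rw [← integral_const_mul, ← integral_const_mul]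
    refine integral_mono (((c.sqint hθ0).const_mul _).const_mul _)
      ((win_good c (hR.trans_le hRb)).intR ξ) fun y => ?_
    simp only
    have hw := win_nonneg c (b := b) le_rfl y
    have hcos := Real.cos_le_one (ξ * y)
    split_ifs with hy
    · by_cases hy0 : y = 0
      · subst hy0; simp
      · have hyp := abs_pos.mpr hy0
        have e1 : win μ 0 b y = ν y := by
          unfold win
          rw [if_pos ⟨hyp, hy.trans (hθR.trans hRb)⟩]
          exact c.μeq y hy0 (hy.trans (hθR.trans hRδ))
        have h5 : |ξ * y| ≤ Real.pi := by
          rw [abs_mul]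
          calc |ξ| * |y| ≤ |ξ| * θ := by gcongr
            _ = 1 := by rw [hθ]; field_simp
            _ ≤ Real.pi := by linarith [Real.pi_gt_three]
        have h6 := Real.cos_le_one_sub_mul_cos_sq h5
        rw [e1]
        have := mul_le_mul_of_nonneg_right (show 2 / Real.pi ^ 2 * (ξ * y) ^ 2 ≤ 1 - Real.cos (ξ * y) by linarith) (c.νnonneg y)
        linarith
    · rw [mul_zero, mul_zero]
      exact mul_nonneg (by linarith) hw
  refine le_trans ?_ h3
  have e2 : ξ ^ 2 * θ ^ 2 = 1 := by
    rw [hθ, inv_pow, sq_abs]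
    exact mul_inv_cancel₀ (by rw [← sq_abs]; positivity)
  calc 2 / Real.pi ^ 2 * k * C₁ * (|ξ| * R) ^ α * h R
      = 2 / Real.pi ^ 2 * (k * (C₁ * (|ξ| * R) ^ α * h R)) := by ring
    _ ≤ 2 / Real.pi ^ 2 * (k * h θ) := by gcongr
    _ = 2 / Real.pi ^ 2 * (ξ ^ 2 * (k * (θ ^ 2 * h θ))) := by
      rw [show ξ ^ 2 * (k * (θ ^ 2 * h θ)) = (ξ ^ 2 * θ ^ 2) * (k * h θ) by ring, e2, one_mul]
    _ ≤ _ := by gcongr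

lemma subexp {a α : ℝ} (ha : 0 < a) (hα : 0 < α) : ∃ D : ℝ, 0 < D ∧ ∀ s : ℝ, 1 ≤ s →
    Real.exp (-(a * s ^ α)) ≤ D * ((1 + s ^ 2) ^ 2)⁻¹ := by
  obtain ⟨n, hn⟩ := exists_nat_ge (4 / α)
  have hn' : 4 ≤ α * n := by rw [div_le_iff₀ hα] at hn; linarith
  refine ⟨4 * n.factorial / a ^ n, by positivity, fun s hs => ?_⟩
  have hs0 : 0 < s := by linarith
  have h1 := Real.pow_div_factorial_le_exp (a * s ^ α) (by positivity) n
  have h2 : (1 + s ^ 2) ^ 2 ≤ 4 * (s ^ α) ^ n := by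
    have : s ^ (4:ℕ) ≤ (s ^ α) ^ n := by
      rw [← Real.rpow_natCast, ← Real.rpow_natCast, ← Real.rpow_mul hs0.le]
      exact Real.rpow_le_rpow_of_exponent_le hs (by push_cast; exact hn')
    have h3 : 1 + s ^ 2 ≤ 2 * s ^ 2 := by nlinarith
    have h4 : (1 + s ^ 2) ^ 2 ≤ (2 * s ^ 2) ^ 2 := by gcongr
    nlinarith
  rw [Real.exp_neg, inv_le_comm₀ (Real.exp_pos _) (by positivity), mul_inv, inv_inv]
  refine le_trans ?_ h1
  rw [mul_pow]
  calc (4 * (n.factorial:ℝ) / a ^ n)⁻¹ * (1 + s ^ 2) ^ 2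
      ≤ (4 * (n.factorial:ℝ) / a ^ n)⁻¹ * (4 * (s ^ α) ^ n) := by gcongr
    _ = _ := by field_simp

lemma decay (c : Ctx ν μ h α C₁ δ) : ∃ D : ℝ, 0 < D ∧ ∀ t R b : ℝ, 0 < t → 0 < R → R ≤ δ → R ≤ b →
    1 ≤ t * h R → ∀ ξ, Real.exp (-t * PhiR (win μ 0 b) ξ) ≤ D * ((1 + (ξ * R) ^ 2) ^ 2)⁻¹ := by
  obtain ⟨a, ha, hlow⟩ := phi_lower c
  obtain ⟨D, hD, hsub⟩ := subexp ha c.hα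
  refine ⟨max D 4, lt_max_of_lt_left hD, fun t R b ht hR hRδ hRb hth ξ => ?_⟩
  have e : (ξ * R) ^ 2 = (|ξ| * R) ^ 2 := by rw [mul_pow, mul_pow, sq_abs]
  rw [e]
  rcases le_total 1 (|ξ| * R) with h1 | h1
  · have h2 := hlow R b ξ hR hRδ hRb h1
    have h3 := hsub _ h1
    have h4 : a * (|ξ| * R) ^ α ≤ t * PhiR (win μ 0 b) ξ := by
      have p : 0 ≤ a * (|ξ| * R) ^ α := by positivity
      calc a * (|ξ| * R) ^ α ≤ a * (|ξ| * R) ^ α * (t * h R) := le_mul_of_one_le_right p hth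
        _ = t * (a * (|ξ| * R) ^ α * h R) := by ring
        _ ≤ _ := by gcongr
    calc _ ≤ Real.exp (-(a * (|ξ| * R) ^ α)) := Real.exp_le_exp.mpr (by linarith)
      _ ≤ D * _ := h3
      _ ≤ _ := by gcongr; exact le_max_left _ _
  · have h2 : Real.exp (-t * PhiR (win μ 0 b) ξ) ≤ 1 := by
      rw [Real.exp_le_one_iff]
      have := (win_good c (hR.trans_le hRb)).phiR_nonneg ξ
      nlinarith [mul_nonneg ht.le this]
    refine h2.trans ?_
    rw [← div_eq_mul_inv, one_le_div (by positivity)]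
    have : 0 ≤ |ξ| * R := by positivity
    have h3 : (|ξ| * R) ^ 2 ≤ 1 := by nlinarith
    calc (1 + (|ξ| * R) ^ 2) ^ 2 ≤ (1 + 1) ^ 2 := by gcongr
      _ ≤ _ := by norm_num

lemma mu_bd (c : Ctx ν μ h α C₁ δ) {ρ y : ℝ} (hρ : 0 < ρ) (hy : ρ < |y|) : μ y ≤ 8 * h ρ / ρ := by
  have hy0 : y ≠ 0 := abs_pos.mp (hρ.trans hy)
  have h1 : ∫ z in Set.Icc (ρ/2) ρ, (1/4) * μ y ≤ h ρ := by
    rw [c.hdef ρ hρ, ← integral_indicator measurableSet_Icc]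
    refine integral_mono ?_ (c.hint hρ) fun z => ?_
    · rw [integrable_indicator_iff measurableSet_Icc]
      exact integrableOn_const (by simp)
    · simp only [Set.indicator]
      have hm := c.νnonneg z
      have h0 : 0 ≤ min 1 (z ^ 2 / ρ ^ 2) := le_min zero_le_one (by positivity)
      split_ifs with hz
      · have hz0 : 0 < z := by linarith [hz.1]
        have e1 : (1/4 : ℝ) ≤ min 1 (z ^ 2 / ρ ^ 2) := by
          refine le_min (by norm_num) ?_
          rw [le_div_iff₀ (by positivity)]
          nlinarith [hz.1]
        have e2 : μ y ≤ ν z := (c.μanti z y hz0.ne' (by rw [abs_of_pos hz0]; linarith [hz.2])).trans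
          (c.μbd z hz0.ne').2
        exact mul_le_mul e1 e2 (c.μbd y hy0).1 h0
      · positivity
  rw [setIntegral_const] at h1
  simp only [Measure.real, Real.volume_Icc, smul_eq_mul] at h1
  rw [ENNReal.toReal_ofReal (by linarith)] at h1
  rw [le_div_iff₀ hρ]
  linarith
end

noncomputable def AK (μ : ℝ → ℝ) (b t : ℝ) (k : ℕ) (ξ : ℝ) : ℂ :=
  (Complex.I * ξ) ^ k * (Real.exp (-t * PhiR (win μ 0 b) ξ) : ℂ)

section
variable {ν μ h : ℝ → ℝ} {α C₁ δ : ℝ}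

lemma IF_const_mul (A : ℝ → ℂ) (a : ℂ) (x : ℝ) : IF (fun ξ => a * A ξ) x = a * IF A x := by
  unfold IF
  rw [← integral_const_mul]
  congr 1; ext ξ; ring

lemma IF_sub {A B : ℝ → ℂ} (hA : Integrable A) (hB : Integrable B) (x : ℝ) :
    IF (fun ξ => A ξ - B ξ) x = IF A x - IF B x := by
  unfold IF
  rw [← integral_sub (IF_int hA x) (IF_int hB x)]
  congr 1; ext ξ; ring

lemma AK_int (c : Ctx ν μ h α C₁ δ) {t R b D : ℝ} (hR : 0 < R) (hb : 0 < b)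
    (hD : ∀ ξ, Real.exp (-t * PhiR (win μ 0 b) ξ) ≤ D * ((1 + (ξ * R) ^ 2) ^ 2)⁻¹) {k : ℕ} (hk : k ≤ 2) :
    Integrable (AK μ b t k) := by
  have hc := (win_good c hb).contR
  refine Integrable.mono' ((int_bd hR).const_mul (D * (2 * (R⁻¹ + 0) ^ k))) ?_ (Eventually.of_forall fun ξ => ?_)
  · refine Continuous.aestronglyMeasurable ?_
    unfold AK
    fun_prop
  · unfold AK
    have hD0 : 0 ≤ D := by
      have := (Real.exp_pos _).le.trans (hD 0)
      simpa using this
    have h1 := poly_bd (ξ := ξ) hR (le_refl (0:ℝ)) hk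
    rw [add_zero] at h1
    rw [norm_mul, norm_pow, norm_mul, Complex.norm_I, one_mul, Complex.norm_real, Complex.norm_real, Real.norm_eq_abs,
      Real.norm_eq_abs, Real.abs_exp]
    calc |ξ| ^ k * _ ≤ |ξ| ^ k * (D * ((1 + (ξ * R) ^ 2) ^ 2)⁻¹) := by gcongr; exact hD ξ
      _ = D * (|ξ| ^ k * ((1 + (ξ * R) ^ 2) ^ 2)⁻¹) := by ring
      _ ≤ D * (2 * (R⁻¹ + 0) ^ k * (1 + (ξ * R) ^ 2)⁻¹) := by gcongr
      _ = _ := by ring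

lemma win_big (c : Ctx ν μ h α C₁ δ) {b : ℝ} (hb : 2 * δ ≤ b) : win μ 0 b = win μ 0 (2 * δ) := by
  ext y; unfold win
  by_cases h1 : |y| ≤ 2 * δ
  · simp only [h1, h1.trans hb]
  · rw [if_neg (fun h : 0 < |y| ∧ |y| ≤ 2 * δ => h1 h.2)]
    push Not at h1
    split_ifs
    · exact c.μzero y h1.le
    · rfl

lemma chat_const (σ : ℝ → ℝ) (t ξ : ℝ) : chat (fun y => t * σ y) ξ = t * chat σ ξ := by
  unfold chat; rw [← integral_const_mul]; congr 1; ext y; ring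

lemma int_expabs {R : ℝ} (hR : 0 < R) : Integrable (fun x : ℝ => Real.exp (-(1 / R) * |x|)) ∧
    ∫ x : ℝ, Real.exp (-(1 / R) * |x|) = 2 * R := by
  have hneg : -(1/R) < 0 := by have : 0 < 1/R := by positivity
                               linarith
  have h1 : IntegrableOn (fun x : ℝ => Real.exp (-(1 / R) * x)) (Set.Ioi 0) :=
    integrableOn_exp_mul_Ioi hneg 0
  have h2 : ∫ x in Set.Ioi (0:ℝ), Real.exp (-(1 / R) * x) = R := by
    rw [integral_exp_mul_Ioi hneg 0]; simp
  have h3 : ∫ x : ℝ, Real.exp (-(1 / R) * |x|) = 2 * R := by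
    have := integral_comp_abs (f := fun x : ℝ => Real.exp (-(1 / R) * x))
    rw [this, h2]
  refine ⟨Integrable.of_integral_ne_zero ?_, h3⟩
  rw [h3]; positivity

lemma sq_half_le {z : ℝ} (hz : 0 ≤ z) : (z / 2) ^ 2 * Real.exp (z / 2) ≤ 2 * Real.exp z := by
  have h1 := Real.pow_div_factorial_le_exp (z / 2) (by positivity) 2
  have e : Real.exp z = Real.exp (z / 2) * Real.exp (z / 2) := by rw [← Real.exp_add]; congr 1; ring
  rw [e]
  have := Real.exp_pos (z / 2)
  norm_num at h1
  nlinarith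

lemma near_decomp (c : Ctx ν μ h α C₁ δ) {t R ρ b D : ℝ} (ht : 0 < t) (hR : 0 < R) (hRρ : R ≤ ρ) (hρb : ρ ≤ b)
    (hD : ∀ b ξ, R ≤ b → Real.exp (-t * PhiR (win μ 0 b) ξ) ≤ D * ((1 + (ξ * R) ^ 2) ^ 2)⁻¹)
    {k : ℕ} (hk : k ≤ 2) {B : ℝ → ℝ} (hB : Integrable B) (hEB : ∀ x, ‖IF (AK μ R t k) x‖ ≤ B x) (x : ℝ) :
    ‖IF (AK μ b t k) x‖ ≤ ‖IF (AK μ ρ t k) x‖ + t * (8 * h ρ / ρ) * ∫ y, B y := by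
  have hρ := hR.trans_le hRρ
  have hb := hρ.trans_le hρb
  set M1 := ∫ y, win μ R ρ y with hM1
  set M2 := ∫ y, win μ ρ b y with hM2
  have i1 := win_int c hR ρ
  have i2 := win_int c hρ b
  have hbig := bigjump (AK_int c hR hR (fun ξ => hD R ξ le_rfl) hk) hB hEB (i1.const_mul t) (i2.const_mul t)
    (fun y => mul_nonneg ht.le (win_nonneg c hR.le y)) (fun y => mul_nonneg ht.le (win_nonneg c hρ.le y))
    (S := t * (8 * h ρ / ρ)) (fun y => by
      refine mul_le_mul_of_nonneg_left ?_ ht.le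
      have := c.hpos ρ hρ
      unfold win; split_ifs with hy
      · exact mu_bd c hρ hy.1
      · positivity) x
  rw [integral_const_mul, integral_const_mul, ← hM1, ← hM2] at hbig
  have key : IF (AK μ b t k) x = ((Real.exp (-t * M2) : ℝ) : ℂ) * IF (AK μ ρ t k) x +
      ((Real.exp (-(t * M1 + t * M2)) : ℝ) : ℂ) * IF (fun ξ => AK μ R t k ξ *
        ((Real.exp (chat (fun y => t * win μ R ρ y) ξ) * (Real.exp (chat (fun y => t * win μ ρ b y) ξ) - 1) : ℝ) : ℂ)) x := by
    rw [← IF_const_mul, ← IF_const_mul, ← sub_eq_iff_eq_add',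
      ← IF_sub (AK_int c hR hb (fun ξ => hD b ξ (hRρ.trans hρb)) hk)
      ((AK_int c hR hρ (fun ξ => hD ρ ξ hRρ) hk).const_mul _)]
    congr 1; ext ξ
    unfold AK
    rw [chat_const, chat_const, phi_add c hρ hρb ξ, phi_add c hR hRρ ξ, ← hM1, ← hM2]
    set P := PhiR (win μ 0 R) ξ
    set c1 := chat (win μ R ρ) ξ
    set c2 := chat (win μ ρ b) ξ
    have e : Real.exp (-t * (P + (M1 - c1) + (M2 - c2))) - Real.exp (-t * M2) * Real.exp (-t * (P + (M1 - c1)))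
        = Real.exp (-(t * M1 + t * M2)) * (Real.exp (-t * P) * (Real.exp (t * c1) * (Real.exp (t * c2) - 1))) := by
      simp only [mul_sub, mul_one, ← Real.exp_add]
      congr 2 <;> ring
    have e' := congrArg (fun r : ℝ => (r : ℂ)) e
    simp only [Complex.ofReal_sub, Complex.ofReal_mul] at e'
    simp only [Complex.ofReal_sub, Complex.ofReal_mul]
    linear_combination (Complex.I * ξ) ^ k * e'
  rw [key]
  refine (norm_add_le _ _).trans (add_le_add ?_ ?_)
  · rw [norm_mul, Complex.norm_real, Real.norm_eq_abs, Real.abs_exp]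
    refine mul_le_of_le_one_left (norm_nonneg _) ?_
    rw [Real.exp_le_one_iff]
    have : 0 ≤ M2 := integral_nonneg fun y => win_nonneg c hρ.le y
    nlinarith
  · rw [norm_mul, Complex.norm_real, Real.norm_eq_abs, Real.abs_exp]
    calc _ ≤ Real.exp (-(t * M1 + t * M2)) * (t * (8 * h ρ / ρ) * (∫ y, B y) * Real.exp (t * M1 + t * M2)) := by gcongr
      _ = t * (8 * h ρ / ρ) * (∫ y, B y) * (Real.exp (-(t * M1 + t * M2)) * Real.exp (t * M1 + t * M2)) := by ring
      _ = _ := by rw [← Real.exp_add, neg_add_cancel, Real.exp_zero, mul_one]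

lemma E_bound (c : Ctx ν μ h α C₁ δ) {t R D Λ : ℝ} (ht : 0 < t) (hR : 0 < R) (hD0 : 0 < D)
    (hD : ∀ ξ, Real.exp (-t * PhiR (win μ 0 R) ξ) ≤ D * ((1 + (ξ * R) ^ 2) ^ 2)⁻¹)
    (hΛ : t * h R ≤ Λ) {k : ℕ} (hk : k ≤ 2) (x : ℝ) :
    ‖IF (AK μ R t k) x‖ ≤ 2 * Real.pi * D * R⁻¹ * (2 * R⁻¹) ^ k * Real.exp (Real.exp 1 * Λ) * Real.exp (-(1 / R) * |x|) := by
  have h1 := shift_bound (win_good c hR) hR.le ht hR hD (l := R⁻¹) (by positivity) hk x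
  refine h1.trans ?_
  have hV := win_V c hR
  rw [mul_assoc _ (Real.exp (Real.exp 1 * Λ)), ← Real.exp_add, ← two_mul]
  refine mul_le_mul_of_nonneg_left ?_ (by positivity)
  rw [Real.exp_le_exp]
  have e : t * (R⁻¹ ^ 2 * Real.exp (R⁻¹ * R) * ∫ y, y ^ 2 * win μ 0 R y) ≤ Real.exp 1 * Λ := by
    rw [inv_mul_cancel₀ hR.ne']
    calc _ ≤ t * (R⁻¹ ^ 2 * Real.exp 1 * (R ^ 2 * h R)) := by gcongr
      _ = Real.exp 1 * (t * h R) := by field_simp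
      _ ≤ _ := by gcongr
  have e2 : 1 / R = R⁻¹ := one_div R
  rw [e2]
  linarith
end

section
variable {ν μ h : ℝ → ℝ} {α C₁ δ : ℝ}

/-- the truncated part at level `ρ` -/
lemma trunc_bound (c : Ctx ν μ h α C₁ δ) {t R ρ D Λ : ℝ} (ht : 0 < t) (hR : 0 < R) (hD0 : 0 < D)
    (hRρ : R ≤ ρ)
    (hD : ∀ ξ, Real.exp (-t * PhiR (win μ 0 ρ) ξ) ≤ D * ((1 + (ξ * R) ^ 2) ^ 2)⁻¹)
    (h1 : 1 ≤ t * h R) (hΛ : t * h R ≤ Λ) {k : ℕ} (hk : k ≤ 2) {x : ℝ}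
    (hx : 2 * (1 + 1 / α) * ρ = |x|) :
    ‖IF (AK μ ρ t k) x‖ ≤ 2 * Real.pi * D * (2 * R⁻¹) ^ k * Real.exp (2 * Λ) * (1 / C₁) ^ (1 / α) *
      (t * h ρ / ρ) := by
  have hρ := hR.trans_le hRρ
  have hα := c.hα
  have hC := c.hC₁
  have pR := c.hpos R hR
  have pρ := c.hpos ρ hρ
  have hRh := c.hanti R ρ hR hRρ
  set z := Real.log (h R / h ρ) with hz
  have hz0 : 0 ≤ z := Real.log_nonneg (by rw [one_le_div pρ]; exact hRh)
  have ez : Real.exp z = h R / h ρ := Real.exp_log (by positivity)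
  set l := z / (2 * ρ) with hl
  have hl0 : 0 ≤ l := by positivity
  have hlρ : l * ρ = z / 2 := by rw [hl]; field_simp
  have hb := shift_bound (win_good c hρ) hρ.le ht hR hD hl0 hk x
  have hV := win_V c hρ
  have b1 : t * (l ^ 2 * Real.exp (l * ρ) * ∫ y, y ^ 2 * win μ 0 ρ y) ≤ 2 * Λ := by
    calc _ ≤ t * (l ^ 2 * Real.exp (l * ρ) * (ρ ^ 2 * h ρ)) := by gcongr
      _ = t * ((l * ρ) ^ 2 * Real.exp (l * ρ)) * h ρ := by ring
      _ = t * ((z / 2) ^ 2 * Real.exp (z / 2)) * h ρ := by rw [hlρ]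
      _ ≤ t * (2 * Real.exp z) * h ρ :=
        mul_le_mul_of_nonneg_right (mul_le_mul_of_nonneg_left (sq_half_le hz0) ht.le) pρ.le
      _ = 2 * (t * h R) := by rw [ez]; field_simp
      _ ≤ _ := by linarith
  have b2 : l ≤ R⁻¹ := by
    have s1 := c.hscale hR hRρ
    have s2 : h R / h ρ ≤ (ρ / R) ^ 2 := by
      rw [div_le_iff₀ pρ, div_pow, div_mul_eq_mul_div, le_div_iff₀ (by positivity)]; linarith
    have s3 : z ≤ 2 * (ρ / R) := by
      calc z ≤ Real.log ((ρ / R) ^ 2) := Real.log_le_log (by positivity) s2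
        _ = 2 * Real.log (ρ / R) := by rw [Real.log_pow]; norm_num
        _ ≤ 2 * (ρ / R) := by
          have := Real.log_le_sub_one_of_pos (show 0 < ρ / R by positivity)
          linarith
    rw [hl, div_le_iff₀ (by positivity)]
    calc z ≤ 2 * (ρ / R) := s3
      _ = _ := by field_simp
  have b3 : Real.exp (-l * |x|) ≤ t * h ρ * ((1 / C₁) ^ (1 / α) * (R / ρ)) := by
    have e : -l * |x| = -z + (-z) * (1 / α) := by
      rw [← hx, hl]; field_simp; ring
    have q : Real.exp (-z) = h ρ / h R := by rw [Real.exp_neg, ez, inv_div]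
    rw [e, Real.exp_add, Real.exp_mul, q]
    refine mul_le_mul ?_ ?_ (by positivity) (by positivity)
    · rw [div_le_iff₀ pR]; nlinarith
    · have s := c.hlsc R hR (ρ / R) (by rw [one_le_div hR]; exact hRρ)
      rw [div_mul_cancel₀ _ hR.ne'] at s
      have p : 0 < ρ / R := by positivity
      have s' : h ρ / h R ≤ (1 / C₁) * (R / ρ) ^ α := by
        have e3 : (R / ρ) ^ α = ((ρ / R) ^ α)⁻¹ := by
          rw [← Real.inv_rpow p.le, inv_div]
        rw [e3, div_le_iff₀ pR]
        have p' : 0 < (ρ / R) ^ α := by positivity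
        calc h ρ = 1 / C₁ * ((ρ / R) ^ α)⁻¹ * (C₁ * (ρ / R) ^ α * h ρ) := by field_simp
          _ ≤ _ := by gcongr
      calc _ ≤ ((1 / C₁) * (R / ρ) ^ α) ^ (1 / α) := Real.rpow_le_rpow (by positivity) s' (by positivity)
        _ = _ := by
          rw [Real.mul_rpow (by positivity) (by positivity), ← Real.rpow_mul (by positivity),
            mul_one_div_cancel hα.ne', Real.rpow_one]
  refine hb.trans ?_
  rw [Real.exp_add]
  calc _ ≤ 2 * Real.pi * D * R⁻¹ * (R⁻¹ + R⁻¹) ^ k * ((t * h ρ * ((1 / C₁) ^ (1 / α) * (R / ρ))) * Real.exp (2 * Λ)) := by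
        gcongr
    _ = _ := by rw [← two_mul]; field_simp

lemma near_bound (c : Ctx ν μ h α C₁ δ) (Λ : ℝ) : ∃ K : ℝ, 0 < K ∧ ∀ t R x : ℝ, ∀ k : ℕ, 0 < t → 0 < R → R ≤ δ →
    1 ≤ t * h R → t * h R ≤ Λ → k ≤ 2 →
    R ^ k * ‖IF (AK μ (2 * δ) t k) x‖ ≤ K * R⁻¹ ∧
    (2 * (1 + 1 / α) * R ≤ |x| → R ^ k * ‖IF (AK μ (2 * δ) t k) x‖ ≤ K * (t * h |x| / |x|)) := by
  obtain ⟨D, hD0, hD⟩ := decay c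
  have hα := c.hα
  have hC := c.hC₁
  have hδ := c.hδ
  set A := 2 * (1 + 1 / α) with hA
  have hA0 : 0 < A := by positivity
  have hA1 : 1 ≤ A := by
    have : 0 < 1 / α := by positivity
    rw [hA]; linarith
  set K1 := 2 * Real.pi * D * 4 * Real.exp (2 * Λ) * (1 / C₁) ^ (1 / α) with hK1
  set K2 := 8 * (4 * Real.pi * D * 4 * Real.exp (Real.exp 1 * Λ)) with hK2
  have pK1 : 0 < K1 := by positivity
  have pK2 : 0 < K2 := by positivity
  have h2k : ∀ k : ℕ, k ≤ 2 → (2:ℝ) ^ k ≤ 4 := by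
    intro k hk; interval_cases k <;> norm_num
  refine ⟨max (2 * Real.pi * D) ((K1 + K2) * A ^ 3), lt_max_of_lt_left (by positivity),
    fun t R x k ht hR hRδ h1 hΛ hk => ⟨?_, fun hx => ?_⟩⟩
  · have hb := shift_bound (win_good c (b := 2 * δ) (by positivity)) (by positivity) ht hR
      (hD t R (2 * δ) ht hR hRδ (by linarith) h1) le_rfl hk x
    simp only [neg_zero, zero_mul, add_zero, ne_eq, OfNat.ofNat_ne_zero, not_false_eq_true, zero_pow, mul_zero, Real.exp_zero, mul_one] at hb
    calc _ ≤ R ^ k * (2 * Real.pi * D * R⁻¹ * R⁻¹ ^ k) := by gcongr; exact hb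
      _ = (2 * Real.pi * D) * R⁻¹ := by rw [inv_pow]; field_simp
      _ ≤ _ := by gcongr; exact le_max_left _ _
  · set ρ := |x| / A with hρd
    have hxρ : A * ρ = |x| := by rw [hρd]; field_simp
    have hRρ : R ≤ ρ := by rw [hρd, le_div_iff₀ hA0]; linarith
    have hρ := hR.trans_le hRρ
    have pρ := c.hpos ρ hρ
    have hx0 : 0 < |x| := by rw [← hxρ]; positivity
    have hwin : AK μ (2 * δ) t k = AK μ (ρ + 2 * δ) t k := by
      unfold AK; rw [win_big c (b := ρ + 2 * δ) (by linarith)]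
    have hDD : ∀ b ξ, R ≤ b → Real.exp (-t * PhiR (win μ 0 b) ξ) ≤ D * ((1 + (ξ * R) ^ 2) ^ 2)⁻¹ :=
      fun b ξ hb => hD t R b ht hR hRδ hb h1 ξ
    obtain ⟨iE, vE⟩ := int_expabs hR
    have d1 := near_decomp c ht hR hRρ (show ρ ≤ ρ + 2 * δ by linarith) hDD hk (iE.const_mul _)
      (fun x => E_bound c ht hR hD0 (fun ξ => hDD R ξ le_rfl) hΛ hk x) x
    rw [integral_const_mul, vE] at d1
    have d2 := trunc_bound c ht hR hD0 hRρ (fun ξ => hDD ρ ξ hRρ) h1 hΛ hk hxρ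
    rw [hwin]
    have hhx : h ρ ≤ A ^ 2 * h |x| := by
      have := c.hscale hρ (show ρ ≤ |x| by rw [← hxρ]; nlinarith)
      have e : |x| ^ 2 = A ^ 2 * ρ ^ 2 := by rw [← hxρ]; ring
      rw [e] at this
      have p : 0 < ρ ^ 2 := by positivity
      nlinarith
    have f1 : t * h ρ / ρ ≤ A ^ 3 * (t * h |x| / |x|) := by
      calc t * h ρ / ρ ≤ t * (A ^ 2 * h |x|) / ρ := by gcongr
        _ = A ^ 3 * (t * h |x| / |x|) := by rw [← hxρ]; field_simp
    have phx := c.hpos _ hx0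
    have g1 : R ^ k * ‖IF (AK μ ρ t k) x‖ ≤ K1 * (t * h ρ / ρ) := by
      calc _ ≤ R ^ k * (2 * Real.pi * D * (2 * R⁻¹) ^ k * Real.exp (2 * Λ) * (1 / C₁) ^ (1 / α) * (t * h ρ / ρ)) := by gcongr
        _ = 2 * Real.pi * D * (2 : ℝ) ^ k * Real.exp (2 * Λ) * (1 / C₁) ^ (1 / α) * (t * h ρ / ρ) := by
          rw [mul_pow, inv_pow]; field_simp
        _ ≤ K1 * (t * h ρ / ρ) := by rw [hK1]; gcongr; exact h2k k hk
    have g2 : R ^ k * (t * (8 * h ρ / ρ) * (2 * Real.pi * D * R⁻¹ * (2 * R⁻¹) ^ k * Real.exp (Real.exp 1 * Λ) * (2 * R))) ≤ K2 * (t * h ρ / ρ) := by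
      calc _ = 8 * (4 * Real.pi * D * (2:ℝ) ^ k * Real.exp (Real.exp 1 * Λ)) * (t * h ρ / ρ) := by
            rw [mul_pow, inv_pow]; field_simp; ring
        _ ≤ _ := by rw [hK2]; gcongr; exact h2k k hk
    calc _ ≤ R ^ k * (_ + _) := mul_le_mul_of_nonneg_left d1 (by positivity)
      _ ≤ (K1 + K2) * (t * h ρ / ρ) := by rw [mul_add]; linarith
      _ ≤ (K1 + K2) * (A ^ 3 * (t * h |x| / |x|)) := by gcongr
      _ = (K1 + K2) * A ^ 3 * (t * h |x| / |x|) := by ring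
      _ ≤ _ := by gcongr; exact le_max_right _ _

lemma far_bound (c : Ctx ν μ h α C₁ δ) {τ ε p Q : ℝ} (hτ : 0 < τ) (hQ : 0 < Q) (hδ1 : δ ≤ 1 / 24)
    (hδε : p + 3 / α ≤ ε / (8 * δ)) : ∃ K : ℝ, 0 < K ∧ ∀ t R x : ℝ, ∀ k : ℕ, 0 < t → t ≤ τ → 0 < R → R ≤ δ →
    1 ≤ t * h R → R⁻¹ ≤ Q * t ^ (-(1 / α)) → ε ≤ |x| → k ≤ 2 →
    R ^ k * ‖IF (AK μ (2 * δ) t k) x‖ ≤ K * (t ^ p * Real.exp (-|x|)) := by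
  obtain ⟨D, hD0, hD⟩ := decay c
  have hα := c.hα
  have hδ := c.hδ
  set C := Real.exp 1 * τ with hCdef
  have hC0 : 0 < C := by positivity
  have p2 := c.hpos (2 * δ) (by positivity)
  refine ⟨2 * Real.pi * D * Q * (1 + α) ^ 2 * Real.exp (2 * C * h (2 * δ)) * C ^ (-(p + 1 / α)), by positivity, ?_⟩
  intro t R x k ht htτ hR hRδ h1 hRQ hx hk
  set z := Real.log (C / t) with hz
  have ez : Real.exp z = C / t := Real.exp_log (by positivity)
  have hz1 : 1 ≤ z := by
    rw [hz, Real.le_log_iff_exp_le (by positivity), le_div_iff₀ ht, hCdef]; gcongr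
  set l := z / (4 * δ) with hl
  have hl0 : 0 ≤ l := by positivity
  have hlρ : l * (2 * δ) = z / 2 := by rw [hl]; field_simp; norm_num
  have hb := shift_bound (win_good c (b := 2 * δ) (by positivity)) (by positivity) ht hR
      (hD t R (2 * δ) ht hR hRδ (by linarith) h1) hl0 hk x
  have hV := win_V c (b := 2 * δ) (by positivity)
  have b1 : t * (l ^ 2 * Real.exp (l * (2 * δ)) * ∫ y, y ^ 2 * win μ 0 (2 * δ) y) ≤ 2 * C * h (2 * δ) := by
    calc _ ≤ t * (l ^ 2 * Real.exp (l * (2 * δ)) * ((2 * δ) ^ 2 * h (2 * δ))) := by gcongr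
      _ = t * ((l * (2 * δ)) ^ 2 * Real.exp (l * (2 * δ))) * h (2 * δ) := by ring
      _ = t * ((z / 2) ^ 2 * Real.exp (z / 2)) * h (2 * δ) := by rw [hlρ]
      _ ≤ t * (2 * Real.exp z) * h (2 * δ) :=
        mul_le_mul_of_nonneg_right (mul_le_mul_of_nonneg_left (sq_half_le (by linarith)) ht.le) p2.le
      _ = 2 * C * h (2 * δ) := by rw [ez]; field_simp
  have b2 : R ^ k * (R⁻¹ + l) ^ k ≤ (1 + α) ^ 2 * Real.exp (2 * z / α) := by
    have s1 : R * (R⁻¹ + l) ≤ 1 + z := by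
      rw [mul_add, mul_inv_cancel₀ hR.ne']
      have : R * l ≤ δ * l := by gcongr
      have e : δ * l = z / 4 := by rw [hl]; field_simp
      linarith
    have s0 : 0 ≤ R * (R⁻¹ + l) := by positivity
    have s2 : 1 + z ≤ (1 + α) * Real.exp (z / α) := by
      have := Real.add_one_le_exp (z / α)
      calc 1 + z ≤ (1 + α) * (z / α + 1) := by
            have : (1 + α) * (z / α + 1) = 1 + z + (z / α + α) := by field_simp; ring
            rw [this]
            have : 0 ≤ z / α + α := by positivity
            linarith
        _ ≤ _ := by gcongr
    rw [← mul_pow]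
    calc (R * (R⁻¹ + l)) ^ k ≤ (1 + z) ^ k := by gcongr
      _ ≤ (1 + z) ^ 2 := pow_le_pow_right₀ (by linarith) hk
      _ ≤ ((1 + α) * Real.exp (z / α)) ^ 2 := by gcongr
      _ = _ := by rw [mul_pow, ← Real.exp_nat_mul]; congr 2; push_cast; ring
  have b3 : Real.exp (-l * |x|) ≤ Real.exp (-|x|) * Real.exp (-z * (p + 3 / α)) := by
    rw [← Real.exp_add, Real.exp_le_exp]
    have e : l * |x| = z * (|x| / (8 * δ)) + z * (|x| / (8 * δ)) := by rw [hl]; field_simp; ring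
    have s1 : |x| ≤ |x| / (8 * δ) := by
      rw [le_div_iff₀ (by positivity)]
      nlinarith [abs_nonneg x]
    have s2 : |x| / (8 * δ) ≤ z * (|x| / (8 * δ)) := le_mul_of_one_le_left (by positivity) hz1
    have s3 : p + 3 / α ≤ |x| / (8 * δ) := hδε.trans (by gcongr)
    have s4 : z * (p + 3 / α) ≤ z * (|x| / (8 * δ)) := by gcongr
    linarith
  have ezz : Real.exp (-z) = t / C := by rw [Real.exp_neg, ez, inv_div]
  have b4 : Real.exp (2 * z / α) * Real.exp (-z * (p + 3 / α)) * t ^ (-(1 / α)) = C ^ (-(p + 1 / α)) * t ^ p := by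
    rw [← Real.exp_add, show 2 * z / α + -z * (p + 3 / α) = -z * (p + 1 / α) by field_simp; ring,
      Real.exp_mul, ezz, Real.div_rpow ht.le hC0.le, Real.rpow_neg hC0.le, div_mul_eq_mul_div, ← Real.rpow_add ht,
      show p + 1 / α + -(1 / α) = p by ring]
    field_simp
  have ht0 : 0 < t ^ (-(1 / α)) := by positivity
  calc _ ≤ R ^ k * (_ * Real.exp (_ + _)) := mul_le_mul_of_nonneg_left hb (by positivity)
    _ = 2 * Real.pi * D * R⁻¹ * (R ^ k * (R⁻¹ + l) ^ k) * (Real.exp (-l * |x|) *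
        Real.exp (t * (l ^ 2 * Real.exp (l * (2 * δ)) * ∫ y, y ^ 2 * win μ 0 (2 * δ) y))) := by
      rw [Real.exp_add]; ring
    _ ≤ 2 * Real.pi * D * (Q * t ^ (-(1 / α))) * ((1 + α) ^ 2 * Real.exp (2 * z / α)) *
        ((Real.exp (-|x|) * Real.exp (-z * (p + 3 / α))) * Real.exp (2 * C * h (2 * δ))) := by
      gcongr
    _ = 2 * Real.pi * D * Q * (1 + α) ^ 2 * Real.exp (2 * C * h (2 * δ)) * (Real.exp (2 * z / α) * Real.exp (-z * (p + 3 / α)) * t ^ (-(1 / α))) * Real.exp (-|x|) := by ring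
    _ = _ := by rw [b4]; ring
end

section
variable {ν μ h : ℝ → ℝ} {α C₁ δ : ℝ}

lemma kernel_bound (c : Ctx ν μ h α C₁ δ) {hinv : ℝ → ℝ} (hip : ∀ s : ℝ, 0 < s → 0 < hinv s)
    (hir : ∀ s : ℝ, 0 < s → h (hinv s) = s) {τ ε p : ℝ} (hτ : 0 < τ) (hε : 0 < ε) (hδ1 : δ ≤ 1 / 24)
    (hmono : ∀ t, 0 < t → t ≤ τ → hinv (1 / t) ≤ hinv (1 / τ))
    (hδε : p + 3 / α ≤ ε / (8 * δ)) : ∃ K : ℝ, 0 < K ∧ ∀ t x : ℝ, ∀ k : ℕ, 0 < t → t ≤ τ → k ≤ 2 →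
    Integrable (AK μ (2 * δ) t k) ∧
    (hinv (1 / t)) ^ k * ‖IF (AK μ (2 * δ) t k) x‖ ≤ K * gstar h hinv t x ∧
    (hinv (1 / t)) ^ k * ‖IF (AK μ (2 * δ) t k) x‖ ≤ K * tg h hinv τ ε p t x := by
  have hα := c.hα
  have hδ := c.hδ
  have hC := c.hC₁
  set A := 2 * (1 + 1 / α) with hA
  have hA0 : 0 < A := by positivity
  have hA1 : 1 ≤ A := by
    have : 0 < 1 / α := by positivity
    rw [hA]; linarith
  set rτ := hinv (1 / τ) with hrτ
  have prτ : 0 < rτ := hip _ (by positivity)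
  set κ := min 1 (δ / rτ) / A with hκ
  have hκ0 : 0 < κ := by
    have : 0 < min 1 (δ / rτ) := lt_min one_pos (by positivity)
    positivity
  have hκ1 : κ ≤ 1 := by
    rw [hκ, div_le_one hA0]; exact (min_le_left _ _).trans hA1
  set Q := κ⁻¹ * (rτ⁻¹ * (τ / C₁) ^ (1 / α)) with hQ
  have hQ0 : 0 < Q := by positivity
  obtain ⟨K1, hK1, hnear⟩ := near_bound c ((κ ^ 2)⁻¹)
  obtain ⟨K3, hK3, hfar⟩ := far_bound c hτ hQ0 hδ1 hδε
  obtain ⟨D, hD0, hD⟩ := decay c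
  set cε := min (1 / rτ) (τ * h ε / ε) * Real.exp ε / τ ^ p with hcε
  have hcε0 : 0 < cε := by
    have := c.hpos ε hε
    have : 0 < min (1 / rτ) (τ * h ε / ε) := lt_min (by positivity) (by positivity)
    positivity
  set K := (κ ^ 2)⁻¹ * (K1 * κ⁻¹ + K3 / cε) with hK
  have hK0 : 0 < K := by positivity
  refine ⟨K, hK0, fun t x k ht htτ hk => ?_⟩
  set r := hinv (1 / t) with hr
  have pr : 0 < r := hip _ (by positivity)
  have hrh : h r = 1 / t := hir _ (by positivity)
  have hrτ' : r ≤ rτ := hmono t ht htτ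
  set R := min r δ / A with hRdef
  have hR0 : 0 < R := by
    have : 0 < min r δ := lt_min pr hδ
    positivity
  have hmr : min r δ ≤ r := min_le_left _ _
  have hRr : R ≤ r := (div_le_self (by positivity) hA1).trans hmr
  have hRδ : R ≤ δ := (div_le_self (by positivity) hA1).trans (min_le_right _ _)
  have hκR : κ * r ≤ R := by
    rw [hκ, hRdef, div_mul_eq_mul_div]
    gcongr
    refine le_min ?_ ?_
    · exact mul_le_of_le_one_left pr.le (min_le_left _ _)
    · calc _ ≤ δ / rτ * r := by gcongr; exact min_le_right _ _
        _ ≤ δ / rτ * rτ := by gcongr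
        _ = δ := by field_simp
  have h1 : 1 ≤ t * h R := by
    have := c.hanti R r hR0 hRr
    rw [hrh] at this
    calc 1 = t * (1 / t) := by field_simp
      _ ≤ _ := by gcongr
  have hΛ : t * h R ≤ (κ ^ 2)⁻¹ := by
    have s := c.hscale hR0 hRr
    rw [hrh] at s
    have s1 : (κ * r) ^ 2 * h R ≤ R ^ 2 * h R := by
      have := c.hpos R hR0
      gcongr
    have s2 : (κ * r) ^ 2 * h R ≤ r ^ 2 * (1 / t) := s1.trans s
    have s3 : κ ^ 2 * h R ≤ 1 / t := by
      have : r ^ 2 * (κ ^ 2 * h R) ≤ r ^ 2 * (1 / t) := by linarith [mul_pow κ r 2]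
      exact le_of_mul_le_mul_left this (by positivity)
    rw [← one_div, le_div_iff₀ (by positivity)]
    rw [le_div_iff₀ ht] at s3
    linarith
  have hRinv : R⁻¹ ≤ κ⁻¹ * (1 / r) := by
    rw [one_div, ← mul_inv]
    exact inv_anti₀ (by positivity) hκR
  have hrinv : 1 / r ≤ rτ⁻¹ * (τ / C₁) ^ (1 / α) * t ^ (-(1 / α)) := by
    have s := c.hlsc r pr (rτ / r) (by rw [one_le_div pr]; exact hrτ')
    rw [div_mul_cancel₀ _ pr.ne', hrh, hrτ, hir _ (by positivity), ← hrτ] at s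
    have s1 : (rτ / r) ^ α ≤ τ / C₁ * t⁻¹ := by
      have p : 0 < (rτ / r) ^ α := by positivity
      calc (rτ / r) ^ α = τ / C₁ * (C₁ * (rτ / r) ^ α * (1 / τ)) := by field_simp
        _ ≤ τ / C₁ * (1 / t) := by gcongr
        _ = _ := by rw [one_div]
    have s2 := Real.rpow_le_rpow (by positivity) s1 (show 0 ≤ 1 / α by positivity)
    rw [← Real.rpow_mul (by positivity), mul_one_div_cancel hα.ne', Real.rpow_one,
      Real.mul_rpow (by positivity) (by positivity), Real.inv_rpow ht.le, ← Real.rpow_neg ht.le] at s2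
    calc 1 / r = rτ⁻¹ * (rτ / r) := by field_simp
      _ ≤ rτ⁻¹ * ((τ / C₁) ^ (1 / α) * t ^ (-(1 / α))) := by gcongr
      _ = _ := by ring
  have hRQ : R⁻¹ ≤ Q * t ^ (-(1 / α)) := by
    calc R⁻¹ ≤ κ⁻¹ * (1 / r) := hRinv
      _ ≤ κ⁻¹ * (rτ⁻¹ * (τ / C₁) ^ (1 / α) * t ^ (-(1 / α))) := by gcongr
      _ = _ := by rw [hQ]; ring
  set N := ‖IF (AK μ (2 * δ) t k) x‖ with hN
  have hN0 : 0 ≤ N := norm_nonneg _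
  have hrk : r ^ k * N ≤ (κ ^ 2)⁻¹ * (R ^ k * N) := by
    rw [← mul_assoc]
    gcongr
    have : κ ^ 2 * r ^ k ≤ R ^ k := by
      calc κ ^ 2 * r ^ k ≤ κ ^ k * r ^ k := by
            gcongr ?_ * _
            exact pow_le_pow_of_le_one hκ0.le hκ1 hk
        _ = (κ * r) ^ k := by rw [mul_pow]
        _ ≤ _ := by gcongr
    calc r ^ k = (κ ^ 2)⁻¹ * (κ ^ 2 * r ^ k) := by field_simp
      _ ≤ _ := by gcongr
  obtain ⟨n1, n2⟩ := hnear t R x k ht hR0 hRδ h1 hΛ hk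
  have m1 : r ^ k * N ≤ K * (1 / r) := by
    calc _ ≤ (κ ^ 2)⁻¹ * (R ^ k * N) := hrk
      _ ≤ (κ ^ 2)⁻¹ * (K1 * (κ⁻¹ * (1 / r))) :=
        mul_le_mul_of_nonneg_left (n1.trans (mul_le_mul_of_nonneg_left hRinv hK1.le)) (by positivity)
      _ = (κ ^ 2)⁻¹ * (K1 * κ⁻¹) * (1 / r) := by ring
      _ ≤ _ := by
        rw [hK]; gcongr
        have : 0 ≤ K3 / cε := by positivity
        linarith
  have m2 : x ≠ 0 → r ^ k * N ≤ K * (t * h |x| / |x|) := by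
    intro hx
    have hx0 := abs_pos.mpr hx
    have phx := c.hpos _ hx0
    rcases le_or_gt (A * R) |x| with hh | hh
    · calc _ ≤ (κ ^ 2)⁻¹ * (R ^ k * N) := hrk
        _ ≤ (κ ^ 2)⁻¹ * (K1 * (t * h |x| / |x|)) :=
          mul_le_mul_of_nonneg_left (n2 hh) (by positivity)
        _ = (κ ^ 2)⁻¹ * K1 * (t * h |x| / |x|) := by ring
        _ ≤ _ := by
          rw [hK]; gcongr
          have : 0 ≤ K3 / cε := by positivity
          have : 1 ≤ κ⁻¹ := (one_le_inv₀ hκ0).mpr hκ1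
          nlinarith
    · have hxr : |x| ≤ r := by
        have : A * R = min r δ := by rw [hRdef]; field_simp
        linarith
      have := c.hanti _ _ hx0 hxr
      rw [hrh] at this
      refine m1.trans (mul_le_mul_of_nonneg_left ?_ hK0.le)
      calc 1 / r ≤ 1 / |x| := by gcongr
        _ = t * (1 / t) / |x| := by field_simp
        _ ≤ _ := by gcongr
  have m3 : ε ≤ |x| → r ^ k * N ≤ K * (cε * (t ^ p * Real.exp (-|x|))) := by
    intro hx
    calc _ ≤ (κ ^ 2)⁻¹ * (R ^ k * N) := hrk
      _ ≤ (κ ^ 2)⁻¹ * (K3 * (t ^ p * Real.exp (-|x|))) := by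
        exact mul_le_mul_of_nonneg_left (hfar t R x k ht htτ hR0 hRδ h1 hRQ hx hk) (by positivity)
      _ = (κ ^ 2)⁻¹ * (K3 / cε) * (cε * (t ^ p * Real.exp (-|x|))) := by field_simp
      _ ≤ _ := by
        rw [hK]; gcongr
        have : 0 ≤ K1 * κ⁻¹ := by positivity
        linarith
  refine ⟨AK_int c hR0 (by positivity) (hD t R (2 * δ) ht hR0 hRδ (by linarith) h1) hk, ?_, ?_⟩
  · unfold gstar
    split_ifs with hx
    · exact m1
    · rw [mul_min_of_nonneg _ _ hK0.le]
      exact le_min m1 (m2 hx)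
  · unfold tg
    split_ifs with hx hxε
    · exact m1
    · rw [mul_min_of_nonneg _ _ hK0.le]
      exact le_min m1 (m2 hx)
    · exact m3 (not_lt.mp hxε)

lemma IF_deriv {A : ℝ → ℂ} (hA : Integrable A) (hA' : Integrable (fun ξ : ℝ => Complex.I * ξ * A ξ)) (x : ℝ) :
    HasDerivAt (IF A) (IF (fun ξ : ℝ => Complex.I * ξ * A ξ) x) x := by
  have := (hasDerivAt_integral_of_dominated_loc_of_deriv_le (μ := volume) (𝕜 := ℝ)
    (F := fun (x : ℝ) (ξ : ℝ) => Complex.exp (Complex.I * x * ξ) * A ξ)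
    (F' := fun (x : ℝ) (ξ : ℝ) => Complex.exp (Complex.I * x * ξ) * (Complex.I * ξ * A ξ))
    (bound := fun ξ => ‖Complex.I * ξ * A ξ‖) (x₀ := x) (s := Set.univ) univ_mem
    (Eventually.of_forall fun y => (IF_int hA y).aestronglyMeasurable) (IF_int hA x)
    (IF_int hA' x).aestronglyMeasurable (Eventually.of_forall fun ξ y _ => ?_) hA'.norm
    (Eventually.of_forall fun ξ y _ => ?_)).2
  · exact this
  · rw [norm_mul, Complex.norm_exp]; simp
  · have h1 : HasDerivAt (fun y : ℝ => Complex.I * (y : ℂ) * ξ) (Complex.I * 1 * ξ) y :=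
      ((Complex.ofRealCLM.hasDerivAt (x := y)).const_mul Complex.I).mul_const _
    have h2 := h1.cexp.mul_const (A ξ)
    refine h2.congr_deriv ?_
    ring

noncomputable def GR (μ : ℝ → ℝ) (δ t : ℝ) (k : ℕ) (x : ℝ) : ℝ :=
  (2 * Real.pi)⁻¹ * (IF (AK μ (2 * δ) t k) x).re

lemma GR_deriv {t : ℝ} {k : ℕ} (h1 : Integrable (AK μ (2 * δ) t k)) (h2 : Integrable (AK μ (2 * δ) t (k + 1)))
    (x : ℝ) : HasDerivAt (GR μ δ t k) (GR μ δ t (k + 1) x) x := by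
  have e : AK μ (2 * δ) t (k + 1) = fun ξ : ℝ => Complex.I * ξ * AK μ (2 * δ) t k ξ := by
    ext ξ; unfold AK; ring
  have hd := IF_deriv h1 (e ▸ h2) x
  rw [← e] at hd
  exact ((Complex.reCLM.hasFDerivAt.comp_hasDerivAt x hd)).const_mul _

lemma GR_bd (t : ℝ) (k : ℕ) (x : ℝ) : |GR μ δ t k x| ≤ ‖IF (AK μ (2 * δ) t k) x‖ := by
  unfold GR
  rw [abs_mul, abs_of_pos (by positivity)]
  have h1 := Complex.abs_re_le_norm (IF (AK μ (2 * δ) t k) x)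
  have h2 : (2 * Real.pi)⁻¹ ≤ 1 := inv_le_one_of_one_le₀ (by linarith [Real.pi_gt_three])
  have := abs_nonneg (IF (AK μ (2 * δ) t k) x).re
  have p : 0 ≤ (2 * Real.pi)⁻¹ := by positivity
  nlinarith

lemma GR_zero (c : Ctx ν μ h α C₁ δ) {t : ℝ} (h1 : Integrable (AK μ (2 * δ) t 0)) (x : ℝ) :
    GR μ δ t 0 x = (2 * Real.pi)⁻¹ * ∫ ξ : ℝ, Real.cos (x * ξ) *
      Real.exp (-t * ∫ y : ℝ, (1 - Real.cos (ξ * y)) * μ y) := by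
  unfold GR IF
  congr 1
  have := integral_re (IF_int h1 x)
  simp only [RCLike.re_eq_complex_re] at this
  rw [← this]
  congr 1; ext ξ
  have e : PhiR (win μ 0 (2 * δ)) ξ = ∫ y : ℝ, (1 - Real.cos (ξ * y)) * μ y := by
    unfold PhiR; congr 1; ext y
    unfold win
    split_ifs with hy
    · rfl
    · by_cases hy0 : y = 0
      · subst hy0; simp
      · have : 2 * δ ≤ |y| := by
          by_contra hh
          exact hy ⟨abs_pos.mpr hy0, (not_le.mp hh).le⟩
        rw [c.μzero y this]
  unfold AK
  rw [e, pow_zero, one_mul, Complex.re_mul_ofReal]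
  congr 1
  rw [show Complex.I * x * ξ = ((x * ξ : ℝ) : ℂ) * Complex.I by push_cast; ring, Complex.exp_ofReal_mul_I_re]
end

section
variable {g g1 g2 T S : ℝ → ℝ} {r K M : ℝ}

lemma fin2 (hr : 0 < r) (hK : 0 < K) (hM : 1 ≤ M) (d1 : ∀ x, HasDerivAt g (g1 x) x)
    (b0 : ∀ x, |g x| ≤ K * T x) (b1 : ∀ x, r * |g1 x| ≤ K * T x) (T0 : ∀ x, 0 ≤ T x)
    (Ta : ∀ x y, |x| ≤ |y| → T y ≤ T x) (Tc : ∀ x y, |y| ≤ r → T x ≤ M * T y) (x u : ℝ) :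
    |g (x + u) - g x| ≤ (K * M) * |u| / r * (T (x + u) + T x) := by
  have t1 := T0 x
  have t2 := T0 (x + u)
  rcases le_or_gt r |u| with hu | hu
  · have e : 1 ≤ |u| / r := by rw [one_le_div hr]; exact hu
    calc |g (x + u) - g x| ≤ |g (x + u)| + |g x| := abs_sub _ _
      _ ≤ K * T (x + u) + K * T x := add_le_add (b0 _) (b0 _)
      _ = K * 1 * 1 * (T (x + u) + T x) := by ring
      _ ≤ K * M * (|u| / r) * (T (x + u) + T x) := by gcongr
      _ = _ := by ring
  · have key : ∀ z ∈ Set.uIcc x (x + u), ‖g1 z‖ ≤ K * M / r * (T (x + u) + T x) := by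
      intro z hz
      have h1 : T z ≤ M * (T (x + u) + T x) := by
        rcases le_or_gt |x| r with hx | hx
        · refine (Tc z x hx).trans ?_
          gcongr; linarith
        · have h2 : T z ≤ T (x + u) + T x := by
            have : |x| ≤ |z| ∨ |x + u| ≤ |z| := by
              rw [Set.mem_uIcc] at hz
              rcases abs_cases x with ⟨e1, _⟩ | ⟨e1, _⟩ <;> rcases abs_cases u with ⟨e2, _⟩ | ⟨e2, _⟩ <;>
              rcases abs_cases (x + u) with ⟨e3, _⟩ | ⟨e3, _⟩ <;> rcases abs_cases z with ⟨e4, _⟩ | ⟨e4, _⟩ <;>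
              rw [e1, e3, e4] <;> rcases hz with hz | hz <;>
              first | (left; linarith [hz.1, hz.2]) | (right; linarith [hz.1, hz.2])
            rcases this with h | h
            · linarith [Ta x z h]
            · linarith [Ta _ z h]
          refine h2.trans (le_mul_of_one_le_left (by positivity) hM)
      have h2 := b1 z
      rw [Real.norm_eq_abs, div_mul_eq_mul_div, le_div_iff₀ hr]
      nlinarith
    have := Convex.norm_image_sub_le_of_norm_hasDerivWithin_le (f := g) (f' := g1) (s := Set.uIcc x (x + u)) (x := x) (y := x + u)
      (fun z _ => (d1 z).hasDerivWithinAt) key (convex_uIcc _ _) Set.left_mem_uIcc Set.right_mem_uIcc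
    rw [Real.norm_eq_abs, Real.norm_eq_abs, add_sub_cancel_left] at this
    refine this.trans (le_of_eq ?_)
    ring

lemma dF (d1 : ∀ x, HasDerivAt g (g1 x) x) (x s : ℝ) :
    HasDerivAt (fun s => g (x + s) + g (x - s)) (g1 (x + s) - g1 (x - s)) s := by
  have h1 : HasDerivAt (fun s => g (x + s)) (g1 (x + s)) s := HasDerivAt.comp_const_add x s (d1 (x + s))
  have h2 : HasDerivAt (fun s => g (x - s)) (-g1 (x - s)) s := HasDerivAt.comp_const_sub x s (d1 (x - s))
  exact h1.add h2

lemma dF_bd (d2 : ∀ x, HasDerivAt g1 (g2 x) x) {x s C : ℝ} (hs : 0 ≤ s)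
    (hC : ∀ z ∈ Set.Icc (x - s) (x + s), |g2 z| ≤ C) : |g1 (x + s) - g1 (x - s)| ≤ C * (2 * s) := by
  have := Convex.norm_image_sub_le_of_norm_hasDerivWithin_le (f := g1) (f' := g2) (s := Set.Icc (x - s) (x + s))
    (x := x - s) (y := x + s) (C := C)
      (fun z _ => (d2 z).hasDerivWithinAt) (fun z hz => hC z hz) (convex_Icc _ _)
      (Set.left_mem_Icc.mpr (by linarith)) (Set.right_mem_Icc.mpr (by linarith))
  rw [Real.norm_eq_abs, Real.norm_eq_abs, show x + s - (x - s) = 2 * s by ring, abs_of_nonneg (show 0 ≤ 2 * s by positivity)] at this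
  exact this

lemma fold_abs (g : ℝ → ℝ) (x u : ℝ) : g (x + u) + g (x - u) = g (x + |u|) + g (x - |u|) := by
  rcases abs_cases u with ⟨e, _⟩ | ⟨e, _⟩ <;> rw [e]
  rw [sub_neg_eq_add, ← sub_eq_add_neg]; ring

lemma fin3 (hr : 0 < r) (hK : 0 < K) (d1 : ∀ x, HasDerivAt g (g1 x) x) (d2 : ∀ x, HasDerivAt g1 (g2 x) x)
    (b2 : ∀ x, r ^ 2 * |g2 x| ≤ K * T x) (T0 : ∀ x, 0 ≤ T x)
    (Ta : ∀ x y, |x| ≤ |y| → T y ≤ T x) (x u : ℝ) :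
    |g (x + u) + g (x - u) - 2 * g x| ≤ (2 * K) * |u| ^ 2 / r ^ 2 * ⨆ ξ ∈ Set.Icc (x - |u|) (x + |u|), T ξ := by
  set P := ⨆ ξ ∈ Set.Icc (x - |u|) (x + |u|), T ξ with hP
  have hbd : ∀ ξ, (⨆ (_ : ξ ∈ Set.Icc (x - |u|) (x + |u|)), T ξ) ≤ T 0 := by
    intro ξ
    exact Real.iSup_le (fun _ => Ta 0 ξ (by rw [abs_zero]; exact abs_nonneg _)) (T0 0)
  have hPle : ∀ z ∈ Set.Icc (x - |u|) (x + |u|), T z ≤ P := by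
    intro z hz
    have h1 : T z = ⨆ (_ : z ∈ Set.Icc (x - |u|) (x + |u|)), T z := by
      have : Nonempty (z ∈ Set.Icc (x - |u|) (x + |u|)) := ⟨hz⟩
      rw [ciSup_const]
    rw [h1]
    exact le_ciSup (f := fun ξ => ⨆ (_ : ξ ∈ Set.Icc (x - |u|) (x + |u|)), T ξ)
      ⟨T 0, by rintro _ ⟨ξ, rfl⟩; exact hbd ξ⟩ z
  have hP0 : 0 ≤ P := (T0 x).trans (hPle x ⟨by linarith [abs_nonneg u], by linarith [abs_nonneg u]⟩)
  rw [fold_abs g x u]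
  have hu0 := abs_nonneg u
  have key : ∀ s ∈ Set.Icc 0 |u|, ‖g1 (x + s) - g1 (x - s)‖ ≤ K / r ^ 2 * P * (2 * |u|) := by
    intro s hs
    have h1 := dF_bd (g1 := g1) d2 (x := x) (C := K / r ^ 2 * P) hs.1 (fun z hz => by
      have h2 := b2 z
      have h3 := hPle z ⟨by linarith [hz.1, hs.2], by linarith [hz.2, hs.2]⟩
      rw [div_mul_eq_mul_div, le_div_iff₀ (by positivity)]
      nlinarith)
    refine h1.trans ?_
    gcongr; exact hs.2
  have := Convex.norm_image_sub_le_of_norm_hasDerivWithin_le (f := fun s => g (x + s) + g (x - s))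
    (f' := fun s => g1 (x + s) - g1 (x - s)) (s := Set.Icc 0 |u|) (x := 0) (y := |u|)
    (fun z _ => (dF d1 x z).hasDerivWithinAt) key (convex_Icc _ _)
    (Set.left_mem_Icc.mpr hu0) (Set.right_mem_Icc.mpr hu0)
  simp only [add_zero, sub_zero, Real.norm_eq_abs, abs_abs] at this
  rw [← two_mul] at this
  refine this.trans (le_of_eq ?_)
  ring

lemma fin4_aux (hr : 0 < r) (hK : 0 < K) (hM : 1 ≤ M) (d1 : ∀ x, HasDerivAt g (g1 x) x)
    (d2 : ∀ x, HasDerivAt g1 (g2 x) x)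
    (b0 : ∀ x, |g x| ≤ K * S x) (b1 : ∀ x, r * |g1 x| ≤ K * S x) (b2 : ∀ x, r ^ 2 * |g2 x| ≤ K * S x)
    (S0 : ∀ x, 0 ≤ S x) (Sd : ∀ y y', |y - y'| ≤ 3 * r → S y ≤ M * S y') {x u w : ℝ} (hw : 0 ≤ w) (hwu : w ≤ u) :
    |(g (x + u) + g (x - u)) - (g (x + w) + g (x - w))| ≤ (2 * K * M) * (u ^ 2 - w ^ 2) / r ^ 2 *
      (S (x + u) + S (x - u) + S (x + w) + S (x - w)) := by
  have s1 := S0 (x + u)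
  have s2 := S0 (x - u)
  have s3 := S0 (x + w)
  have s4 := S0 (x - w)
  have hu := hw.trans hwu
  rcases le_or_gt (r ^ 2) (u ^ 2 - w ^ 2) with hh | hh
  · have e : 1 ≤ (u ^ 2 - w ^ 2) / r ^ 2 := by rw [one_le_div (by positivity)]; exact hh
    calc _ ≤ |g (x + u) + g (x - u)| + |g (x + w) + g (x - w)| := abs_sub _ _
      _ ≤ (|g (x + u)| + |g (x - u)|) + (|g (x + w)| + |g (x - w)|) := add_le_add (abs_add_le _ _) (abs_add_le _ _)
      _ ≤ (K * S (x + u) + K * S (x - u)) + (K * S (x + w) + K * S (x - w)) :=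
        add_le_add (add_le_add (b0 _) (b0 _)) (add_le_add (b0 _) (b0 _))
      _ = 1 * K * 1 * 1 * (S (x + u) + S (x - u) + S (x + w) + S (x - w)) := by ring
      _ ≤ 2 * K * M * ((u ^ 2 - w ^ 2) / r ^ 2) * (S (x + u) + S (x - u) + S (x + w) + S (x - w)) := by
        gcongr; norm_num
      _ = _ := by ring
  · have huw : u - w < r := by
      by_contra hc
      push Not at hc
      nlinarith
    set P := S (x + u) + S (x - u) with hP
    have hP0 : 0 ≤ P := by positivity
    have key : ∀ s ∈ Set.Icc w u, ‖g1 (x + s) - g1 (x - s)‖ ≤ 2 * K * M / r ^ 2 * P * u := by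
      intro s hs
      have hs0 := hw.trans hs.1
      refine le_trans (b := 2 * K * M / r ^ 2 * P * s) ?_ (by gcongr; exact hs.2)
      rcases le_or_gt r s with hrs | hrs
      · have a1 := Sd (x + s) (x + u) (by rw [abs_le]; constructor <;> linarith [hs.1, hs.2])
        have a2 := Sd (x - s) (x - u) (by rw [abs_le]; constructor <;> linarith [hs.1, hs.2])
        have c1 := b1 (x + s)
        have c2 := b1 (x - s)
        have e1 : r * |g1 (x + s) - g1 (x - s)| ≤ K * M * P := by
          have := abs_sub (g1 (x + s)) (g1 (x - s))
          have m1 := mul_le_mul_of_nonneg_left a1 hK.le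
          have m2 := mul_le_mul_of_nonneg_left a2 hK.le
          have m3 := mul_le_mul_of_nonneg_left this hr.le
          rw [hP]; linarith
        rw [Real.norm_eq_abs]
        calc |g1 (x + s) - g1 (x - s)| = (r * |g1 (x + s) - g1 (x - s)|) / r := by field_simp
          _ ≤ K * M * P / r := by gcongr
          _ = K * M / r ^ 2 * P * r := by field_simp
          _ ≤ 2 * K * M / r ^ 2 * P * s := by gcongr; linarith
      · have h1 := dF_bd (g1 := g1) d2 (x := x) (C := K * M / r ^ 2 * P) hs0 (fun z hz => by
          have h2 := b2 z
          have h3 := Sd z (x + u) (by rw [abs_le]; constructor <;> linarith [hz.1, hz.2, hs.1, hs.2])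
          have h4 := mul_le_mul_of_nonneg_left h3 hK.le
          have h5 : K * (M * S (x + u)) ≤ K * (M * P) := by
            gcongr; linarith
          rw [div_mul_eq_mul_div, le_div_iff₀ (by positivity)]
          nlinarith)
        rw [Real.norm_eq_abs]
        refine h1.trans (le_of_eq ?_)
        ring
    have := Convex.norm_image_sub_le_of_norm_hasDerivWithin_le (f := fun s => g (x + s) + g (x - s))
      (f' := fun s => g1 (x + s) - g1 (x - s)) (s := Set.Icc w u) (x := w) (y := u)
      (fun z _ => (dF d1 x z).hasDerivWithinAt) key (convex_Icc _ _)
      (Set.left_mem_Icc.mpr hwu) (Set.right_mem_Icc.mpr hwu)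
    rw [Real.norm_eq_abs, Real.norm_eq_abs, abs_of_nonneg (sub_nonneg.mpr hwu)] at this
    refine this.trans ?_
    have q : u * (u - w) ≤ u ^ 2 - w ^ 2 := by nlinarith
    calc _ = 2 * K * M / r ^ 2 * P * (u * (u - w)) := by ring
      _ ≤ 2 * K * M / r ^ 2 * (P + S (x + w) + S (x - w)) * (u ^ 2 - w ^ 2) := by
        gcongr
        linarith
      _ = _ := by ring

lemma fin4 (hr : 0 < r) (hK : 0 < K) (hM : 1 ≤ M) (d1 : ∀ x, HasDerivAt g (g1 x) x)
    (d2 : ∀ x, HasDerivAt g1 (g2 x) x)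
    (b0 : ∀ x, |g x| ≤ K * S x) (b1 : ∀ x, r * |g1 x| ≤ K * S x) (b2 : ∀ x, r ^ 2 * |g2 x| ≤ K * S x)
    (S0 : ∀ x, 0 ≤ S x) (Sd : ∀ y y', |y - y'| ≤ 3 * r → S y ≤ M * S y') (x u w : ℝ) :
    |g (x + u) + g (x - u) - g (x + w) - g (x - w)| ≤ (2 * K * M) * |(|u| ^ 2 - |w| ^ 2)| / r ^ 2 *
      (S (x + u) + S (x - u) + S (x + w) + S (x - w)) := by
  have eg : g (x + u) + g (x - u) - g (x + w) - g (x - w) =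
      (g (x + |u|) + g (x - |u|)) - (g (x + |w|) + g (x - |w|)) := by
    rw [← fold_abs g x u, ← fold_abs g x w]; ring
  have eS : S (x + u) + S (x - u) + S (x + w) + S (x - w) =
      S (x + |u|) + S (x - |u|) + S (x + |w|) + S (x - |w|) := by
    have := fold_abs S x u
    have := fold_abs S x w
    linarith
  rw [eg, eS]
  rcases le_total |w| |u| with h | h
  · have q : 0 ≤ |u| ^ 2 - |w| ^ 2 := by nlinarith [abs_nonneg w]
    rw [abs_of_nonneg q]
    exact fin4_aux hr hK hM d1 d2 b0 b1 b2 S0 Sd (abs_nonneg w) h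
  · have q : 0 ≤ |w| ^ 2 - |u| ^ 2 := by nlinarith [abs_nonneg u]
    rw [abs_sub_comm, abs_sub_comm (|u| ^ 2), abs_of_nonneg q]
    refine (fin4_aux hr hK hM d1 d2 b0 b1 b2 S0 Sd (abs_nonneg u) h).trans (le_of_eq ?_)
    ring
end

section
variable {ν μ h : ℝ → ℝ} {α C₁ δ : ℝ}

lemma S_nonneg (c : Ctx ν μ h α C₁ δ) {hinv : ℝ → ℝ} {t : ℝ} (ht : 0 < t) (hr : 0 < hinv (1 / t)) (x : ℝ) :
    0 ≤ gstar h hinv t x := by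
  unfold gstar
  split_ifs with hx
  · positivity
  · have hx0 := abs_pos.mpr hx
    have := c.hpos _ hx0
    exact le_min (by positivity) (by positivity)

lemma S_doubling (c : Ctx ν μ h α C₁ δ) {hinv : ℝ → ℝ} {t : ℝ} (ht : 0 < t) (hr : 0 < hinv (1 / t))
    (hrh : h (hinv (1 / t)) = 1 / t) (y y' : ℝ) (hy : |y - y'| ≤ 3 * hinv (1 / t)) :
    gstar h hinv t y ≤ 216 * gstar h hinv t y' := by
  set r := hinv (1 / t) with hrd
  have up : gstar h hinv t y ≤ 1 / r := by
    unfold gstar; split_ifs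
    · exact le_rfl
    · exact min_le_left _ _
  rcases le_or_gt |y'| (6 * r) with h1 | h1
  · have low : 1 / r ≤ 216 * gstar h hinv t y' := by
      have p : 0 < 1 / r := by positivity
      unfold gstar; split_ifs with hx
      · linarith
      · have hx0 := abs_pos.mpr hx
        rw [mul_min_of_nonneg _ _ (by norm_num), ← hrd]
        refine le_min (by linarith) ?_
        have a1 := c.hanti _ _ hx0 h1
        have a2 := c.hscale hr (show r ≤ 6 * r by linarith)
        rw [hrh] at a2
        have a3 : 1 / t ≤ 36 * h (6 * r) := by
          have : r ^ 2 * (1 / t) ≤ r ^ 2 * (36 * h (6 * r)) := by linarith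
          exact le_of_mul_le_mul_left this (by positivity)
        have a4 : 1 ≤ 36 * (t * h |y'|) := by
          rw [div_le_iff₀ ht] at a3; nlinarith
        rw [div_le_iff₀ hr, mul_div_assoc', div_mul_eq_mul_div, le_div_iff₀ hx0]
        nlinarith
    exact up.trans low
  · have hy'0 : y' ≠ 0 := by
      rintro rfl
      rw [abs_zero] at h1; linarith
    have hyy : |y'| ≤ 2 * |y| := by
      have := abs_sub_abs_le_abs_sub y' y
      rw [abs_sub_comm] at this
      linarith
    have p' := abs_pos.mpr hy'0
    have p : 0 < |y| := by linarith
    have ph := c.hpos _ p'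
    have b1 : h |y| ≤ 4 * h |y'| := by
      have a1 := c.hanti (|y'| / 2) |y| (by positivity) (by linarith)
      have a2 := c.hscale (show 0 < |y'| / 2 by positivity) (show |y'| / 2 ≤ |y'| by linarith)
      have : |y'| ^ 2 * h (|y'| / 2) ≤ |y'| ^ 2 * (4 * h |y'|) := by linarith
      have := le_of_mul_le_mul_left this (by positivity)
      linarith
    have b2 : t * h |y| / |y| ≤ 216 * (t * h |y'| / |y'|) := by
      calc t * h |y| / |y| ≤ t * (4 * h |y'|) / (|y'| / 2) := by gcongr; linarith
        _ = 8 * (t * h |y'| / |y'|) := by field_simp; norm_num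
        _ ≤ _ := by gcongr; norm_num
    unfold gstar
    rw [if_neg (abs_pos.mp p), if_neg hy'0, mul_min_of_nonneg _ _ (by norm_num), ← hrd]
    have q : 0 < 1 / r := by positivity
    exact min_le_min (by linarith) b2

lemma T_facts (c : Ctx ν μ h α C₁ δ) {hinv : ℝ → ℝ} {τ ε p : ℝ} (hτ : 0 < τ) (hε : 0 < ε) (hp : 1 ≤ p)
    (hip : ∀ s : ℝ, 0 < s → 0 < hinv s) (hir : ∀ s : ℝ, 0 < s → h (hinv s) = s)
    (hmono : ∀ t, 0 < t → t ≤ τ → hinv (1 / t) ≤ hinv (1 / τ)) :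
    ∃ M : ℝ, 1 ≤ M ∧ ∀ t, 0 < t → t ≤ τ → (∀ x, 0 ≤ tg h hinv τ ε p t x) ∧
    (∀ x y, |x| ≤ |y| → tg h hinv τ ε p t y ≤ tg h hinv τ ε p t x) ∧
    (∀ x y, |y| ≤ hinv (1 / t) → tg h hinv τ ε p t x ≤ M * tg h hinv τ ε p t y) := by
  set rτ := hinv (1 / τ) with hrτ
  have prτ : 0 < rτ := hip _ (by positivity)
  have phε := c.hpos ε hε
  set m := min (1 / rτ) (τ * h ε / ε) with hm
  have pm : 0 < m := lt_min (by positivity) (by positivity)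
  set cε := m * Real.exp ε / τ ^ p with hcε
  have pc : 0 < cε := by positivity
  set L := cε * ((1 / h ε) ^ p * Real.exp (-rτ)) with hL
  have pL : 0 < L := by positivity
  refine ⟨max 1 ((1 / ε) / L), le_max_left _ _, fun t ht htτ => ?_⟩
  set r := hinv (1 / t) with hrd
  have pr : 0 < r := hip _ (by positivity)
  have hrh : h r = 1 / t := hir _ (by positivity)
  have hrr : r ≤ rτ := hmono t ht htτ
  have far : ∀ y, ε ≤ |y| → cε * (t ^ p * Real.exp (-|y|)) ≤ m * (t / τ) := by
    intro y hy
    have e1 : cε * (t ^ p * Real.exp (-|y|)) = m * (t / τ) ^ p * Real.exp (ε - |y|) := by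
      rw [hcε, Real.div_rpow ht.le hτ.le, sub_eq_add_neg, Real.exp_add]; field_simp
    rw [e1]
    have e2 : (t / τ) ^ p ≤ t / τ := by
      have := Real.rpow_le_rpow_of_exponent_ge (show 0 < t / τ by positivity) (by rw [div_le_one hτ]; exact htτ) hp
      rwa [Real.rpow_one] at this
    have e3 : Real.exp (ε - |y|) ≤ 1 := by rw [Real.exp_le_one_iff]; linarith
    calc _ ≤ m * (t / τ) * 1 := by gcongr
      _ = _ := mul_one _
  have far1 : ∀ y, ε ≤ |y| → cε * (t ^ p * Real.exp (-|y|)) ≤ 1 / r := by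
    intro y hy
    calc _ ≤ m * (t / τ) := far y hy
      _ ≤ (1 / rτ) * 1 := by
        gcongr
        · exact min_le_left _ _
        · rw [div_le_one hτ]; exact htτ
      _ ≤ 1 / r := by rw [mul_one]; gcongr
  have far2 : ∀ y, ε ≤ |y| → cε * (t ^ p * Real.exp (-|y|)) ≤ t * h ε / ε := by
    intro y hy
    calc _ ≤ m * (t / τ) := far y hy
      _ ≤ (τ * h ε / ε) * (t / τ) := by gcongr; exact min_le_right _ _
      _ = _ := by field_simp
  have T0 : tg h hinv τ ε p t 0 = 1 / r := by unfold tg; rw [if_pos rfl]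
  have Tup : ∀ x, tg h hinv τ ε p t x ≤ 1 / r := by
    intro x
    unfold tg
    split_ifs with h1 h2
    · exact le_rfl
    · exact min_le_left _ _
    · exact far1 x (not_lt.mp h2)
  have hfrac : ∀ a b : ℝ, 0 < a → a ≤ b → t * h b / b ≤ t * h a / a := by
    intro a b ha hab
    have := c.hanti a b ha hab
    have := c.hpos a ha
    gcongr
  refine ⟨fun x => ?_, fun x y hxy => ?_, fun x y hy => ?_⟩
  · unfold tg
    split_ifs with h1 h2
    · exact (show 0 ≤ 1 / r by positivity)
    · have hx0 := abs_pos.mpr h1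
      have := c.hpos _ hx0
      exact le_min (show 0 ≤ 1 / r by positivity) (by positivity)
    · exact (show 0 ≤ cε * (t ^ p * Real.exp (-|x|)) by positivity)
  · by_cases hx : x = 0
    · rw [hx, T0]; exact Tup y
    have hx0 := abs_pos.mpr hx
    have hy : y ≠ 0 := abs_pos.mp (hx0.trans_le hxy)
    unfold tg
    rw [if_neg hx, if_neg hy]
    by_cases hyε : |y| < ε
    · rw [if_pos hyε, if_pos (hxy.trans_lt hyε)]
      exact min_le_min le_rfl (hfrac _ _ hx0 hxy)
    · rw [if_neg hyε]
      push Not at hyε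
      by_cases hxε : |x| < ε
      · rw [if_pos hxε]
        exact le_min (far1 y hyε) ((far2 y hyε).trans (hfrac _ _ hx0 hxε.le))
      · rw [if_neg hxε]
        show cε * (t ^ p * Real.exp (-|y|)) ≤ cε * (t ^ p * Real.exp (-|x|))
        gcongr
  · refine (Tup x).trans ?_
    have hM1 : 1 ≤ max 1 ((1 / ε) / L) := le_max_left _ _
    by_cases hy0 : y = 0
    · rw [hy0, T0]
      exact le_mul_of_one_le_left (by positivity) hM1
    have py := abs_pos.mpr hy0
    by_cases hyε : |y| < ε
    · have : tg h hinv τ ε p t y = 1 / r := by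
        unfold tg
        rw [if_neg hy0, if_pos hyε]
        refine min_eq_left ?_
        refine le_trans (le_of_eq (show 1 / r = t * h r / r from ?_)) (hfrac _ _ py hy)
        rw [hrh]
        field_simp
      rw [this]
      exact le_mul_of_one_le_left (by positivity) hM1
    · have e : tg h hinv τ ε p t y = cε * (t ^ p * Real.exp (-|y|)) := by
        unfold tg; rw [if_neg hy0, if_neg hyε]
      push Not at hyε
      have hεr : ε ≤ r := hyε.trans hy
      have ht1 : 1 / h ε ≤ t := by
        have := c.hanti ε r hε hεr
        rw [hrh] at this
        rw [div_le_iff₀ phε]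
        rw [div_le_iff₀ ht] at this
        linarith
      have low : L ≤ cε * (t ^ p * Real.exp (-|y|)) := by
        rw [hL]; gcongr; linarith
      rw [e]
      calc 1 / r ≤ 1 / ε := by gcongr
        _ = (1 / ε) / L * L := by field_simp
        _ ≤ max 1 ((1 / ε) / L) * (cε * (t ^ p * Real.exp (-|y|))) := by
          gcongr; exact le_max_right _ _
end

/-- estimates of `g_t^{(δ)}` and its first and second differences by the
majorant `tilde-g_t^{(ε)}`, with `δ = min{δ₀, εα/(8(d+β+2)), ε/(dη₁²)}`. -/
theorem stmt_8 (d : ℕ) (hd : 1 ≤ d)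
    (ν ν' μ μ' : ℝ → ℝ) (h hinv ψδ : ℝ → ℝ) (g : ℝ → ℝ → ℝ)
    (α β C₁ C₂ η₁ η₄ τ ε δ0 δ : ℝ)
    (hα : 0 < α) (hαβ : α ≤ β) (hβ : β < 2) (hC₁ : 0 < C₁) (hC₂ : 0 < C₂)
    (hη₁ : 1 ≤ η₁) (hη₄ : 0 < η₄) (hτ : 0 < τ) (hε0 : 0 < ε) (hε1 : ε ≤ 1)
    (hδ0 : 0 < δ0) (hδ0' : δ0 ≤ 1 / 24)
    (hδdef : δ = min δ0 (min (ε * α / (8 * (d + β + 2))) (ε / (d * η₁ ^ 2))))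
    -- ν is the density of a symmetric infinite Lévy measure on ℝ
    (hνmeas : Measurable ν)
    (hνnonneg : ∀ x : ℝ, 0 ≤ ν x)
    (hνsymm : ∀ x : ℝ, ν (-x) = ν x)
    (hνint : Integrable (fun x : ℝ => min (x ^ 2) 1 * ν x))
    (hνinf : ¬ Integrable ν)
    -- regularity of ν near 0
    (hν'deriv : ∀ x ∈ Set.Ioo (0:ℝ) η₄, HasDerivAt ν (ν' x) x)
    (hν'neg : ∀ x ∈ Set.Ioo (0:ℝ) η₄, ν' x < 0)
    (hν'dec : ∀ x y : ℝ, 0 < x → x < y → y < η₄ → -ν' y / y ≤ -ν' x / x)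
    -- h and its inverse
    (hdef : ∀ r : ℝ, 0 < r → h r = ∫ x : ℝ, min 1 (x ^ 2 / r ^ 2) * ν x)
    (hcont : ContinuousOn h (Set.Ioi 0))
    (hanti : StrictAntiOn h (Set.Ioi 0))
    (hlim0 : Tendsto h (nhdsWithin 0 (Set.Ioi 0)) atTop)
    (hlimtop : Tendsto h atTop (nhds 0))
    (hinvpos : ∀ s : ℝ, 0 < s → 0 < hinv s)
    (hinvr : ∀ s : ℝ, 0 < s → h (hinv s) = s)
    (hinvl : ∀ r : ℝ, 0 < r → hinv (h r) = r)
    -- scaling conditions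
    (hlsc : ∀ θ : ℝ, 0 < θ → ∀ l : ℝ, 1 ≤ l → C₁ * l ^ α * h (l * θ) ≤ h θ)
    (husc : ∀ θ : ℝ, 0 < θ → θ ≤ 1 → ∀ l : ℝ, 0 < l → l ≤ 1 →
      h (l * θ) ≤ C₂ * l ^ (-β) * h θ)
    -- μ = μ^{(δ)} is a symmetric truncation of ν
    (hμmeas : Measurable μ)
    (hμeq : ∀ x : ℝ, 0 < x → x ≤ δ → μ x = ν x)
    (hμbound : ∀ x : ℝ, 0 < x → 0 ≤ μ x ∧ μ x ≤ ν x)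
    (hμzero : ∀ x : ℝ, 2 * δ ≤ x → μ x = 0)
    (hμsymm : ∀ x : ℝ, μ (-x) = μ x)
    (hμ'deriv : ∀ x : ℝ, 0 < x → HasDerivAt μ (μ' x) x)
    (hμ'nonpos : ∀ x : ℝ, 0 < x → μ' x ≤ 0)
    (hμ'dec : ∀ x y : ℝ, 0 < x → x ≤ y → -μ' y / y ≤ -μ' x / x)
    -- ψδ and the heat kernel g_t^{(δ)}
    (hψδdef : ∀ ξ : ℝ, ψδ ξ = ∫ x : ℝ, (1 - Real.cos (ξ * x)) * μ x)
    (hgdef : ∀ t : ℝ, 0 < t → ∀ x : ℝ,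
      g t x = (2 * Real.pi)⁻¹ * ∫ ξ : ℝ, Real.cos (x * ξ) * Real.exp (-t * ψδ ξ)) :
    ∃ c : ℝ, 0 < c ∧ ∀ t : ℝ, 0 < t → t ≤ τ → ∀ x u w : ℝ,
      g t x ≤ c * tg h hinv τ ε ((d + β - 1) / α) t x ∧
      |g t (x + u) - g t x| ≤ c * |u| / hinv (1 / t) *
        (tg h hinv τ ε ((d + β - 1) / α) t (x + u) +
         tg h hinv τ ε ((d + β - 1) / α) t x) ∧
      |g t (x + u) + g t (x - u) - 2 * g t x| ≤ c * |u| ^ 2 / (hinv (1 / t)) ^ 2 *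
        ⨆ ξ ∈ Set.Icc (x - |u|) (x + |u|), tg h hinv τ ε ((d + β - 1) / α) t ξ ∧
      |g t (x + u) + g t (x - u) - g t (x + w) - g t (x - w)| ≤
        c * |(|u| ^ 2 - |w| ^ 2)| / (hinv (1 / t)) ^ 2 *
        (gstar h hinv t (x + u) + gstar h hinv t (x - u) +
         gstar h hinv t (x + w) + gstar h hinv t (x - w)) := by
  have hβ0 : 0 < β := hα.trans_le hαβ
  have hd1 : (1:ℝ) ≤ d := by exact_mod_cast hd
  have hδ : 0 < δ := by
    rw [hδdef]
    exact lt_min hδ0 (lt_min (by positivity) (by positivity))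
  have hδle0 : δ ≤ δ0 := by rw [hδdef]; exact min_le_left _ _
  have hδle1 : δ ≤ ε * α / (8 * (d + β + 2)) := by
    rw [hδdef]; exact (min_le_right _ _).trans (min_le_left _ _)
  have hδ1 : δ ≤ 1 / 24 := hδle0.trans hδ0'
  have hδε : ((d:ℝ) + β - 1) / α + 3 / α ≤ ε / (8 * δ) := by
    rw [le_div_iff₀ (by positivity)] at hδle1
    rw [← add_div, div_le_div_iff₀ hα (by positivity)]
    linarith
  have hp : 1 ≤ ((d:ℝ) + β - 1) / α := by
    rw [one_le_div hα]; linarith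
  have habs : ∀ x, μ |x| = μ x := by
    intro x
    rcases abs_cases x with ⟨e, _⟩ | ⟨e, _⟩ <;> rw [e]
    exact hμsymm x
  have hνabs : ∀ x, ν |x| = ν x := by
    intro x
    rcases abs_cases x with ⟨e, _⟩ | ⟨e, _⟩ <;> rw [e]
    exact hνsymm x
  have hanti' : ∀ r s : ℝ, 0 < r → r ≤ s → h s ≤ h r := fun r s hr hrs =>
    hanti.antitoneOn hr (hr.trans_le hrs) hrs
  have hμa : AntitoneOn μ (Set.Ioi 0) := by
    refine antitoneOn_of_deriv_nonpos (convex_Ioi 0)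
      (fun x hx => (hμ'deriv x hx).continuousAt.continuousWithinAt) ?_ ?_
    · rw [interior_Ioi]
      exact fun x hx => (hμ'deriv x hx).differentiableAt.differentiableWithinAt
    · rw [interior_Ioi]
      intro x hx
      rw [(hμ'deriv x hx).deriv]; exact hμ'nonpos x hx
  have c : Ctx ν μ h α C₁ δ :=
    { hα := hα
      hC₁ := hC₁
      hδ := hδ
      νmeas := hνmeas
      νnonneg := hνnonneg
      νint := hνint
      hdef := hdef
      hanti := hanti'
      hpos := by
        intro r hr
        have h1 : h (r + 1) < h r := hanti hr (show 0 < r + 1 by linarith) (by linarith)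
        refine lt_of_le_of_lt ?_ h1
        rw [hdef _ (by linarith)]
        exact integral_nonneg fun x => mul_nonneg (le_min zero_le_one (by positivity)) (hνnonneg x)
      hlsc := hlsc
      μmeas := hμmeas
      μeq := by
        intro x hx hxδ
        rw [← habs, ← hνabs]; exact hμeq _ (abs_pos.mpr hx) hxδ
      μbd := by
        intro x hx
        rw [← habs, ← hνabs]; exact hμbound _ (abs_pos.mpr hx)
      μzero := by
        intro x hx
        rw [← habs]; exact hμzero _ hx
      μanti := by
        intro x y hx hxy
        rw [← habs, ← habs x]
        have := abs_pos.mpr hx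
        exact hμa this (this.trans_le hxy) hxy }
  have hmono : ∀ t, 0 < t → t ≤ τ → hinv (1 / t) ≤ hinv (1 / τ) := by
    intro t ht htτ
    by_contra hc
    push Not at hc
    have h1 := hanti (hinvpos (1 / τ) (by positivity)) (hinvpos (1 / t) (by positivity)) hc
    rw [hinvr _ (by positivity), hinvr _ (by positivity)] at h1
    have : 1 / τ ≤ 1 / t := by gcongr
    linarith
  obtain ⟨K, hK, hker⟩ := kernel_bound c hinvpos hinvr hτ hε0 hδ1 hmono hδε
  obtain ⟨M, hM, hT⟩ := T_facts c hτ hε0 hp hinvpos hinvr hmono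
  have hM0 : 0 < M := by linarith
  refine ⟨K + K * M + 2 * K + 2 * K * 216, by positivity, fun t ht htτ x u w => ?_⟩
  set r := hinv (1 / t) with hrd
  have pr : 0 < r := hinvpos _ (by positivity)
  obtain ⟨T0, Ta, Tc⟩ := hT t ht htτ
  have S0 := S_nonneg c ht pr
  have Sd := S_doubling c ht pr (hinvr _ (by positivity))
  set T := tg h hinv τ ε (((d:ℝ) + β - 1) / α) t with hTd
  set S := gstar h hinv t with hSd
  have i0 := (hker t 0 0 ht htτ (by norm_num)).1
  have i1 := (hker t 0 1 ht htτ (by norm_num)).1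
  have i2 := (hker t 0 2 ht htτ (by norm_num)).1
  have hg : g t = GR μ δ t 0 := by
    ext x
    rw [hgdef t ht, GR_zero c i0]
    simp only [hψδdef]
  have d1 : ∀ x, HasDerivAt (g t) (GR μ δ t 1 x) x := by
    rw [hg]; exact GR_deriv i0 i1
  have d2 : ∀ x, HasDerivAt (GR μ δ t 1) (GR μ δ t 2 x) x := GR_deriv i1 i2
  have bS : ∀ k : ℕ, k ≤ 2 → ∀ x, r ^ k * |GR μ δ t k x| ≤ K * S x := fun k hk x =>
    (mul_le_mul_of_nonneg_left (GR_bd t k x) (by positivity)).trans (hker t x k ht htτ hk).2.1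
  have bT : ∀ k : ℕ, k ≤ 2 → ∀ x, r ^ k * |GR μ δ t k x| ≤ K * T x := fun k hk x =>
    (mul_le_mul_of_nonneg_left (GR_bd t k x) (by positivity)).trans (hker t x k ht htτ hk).2.2
  have bS0 : ∀ x, |g t x| ≤ K * S x := fun x => by
    have := bS 0 (by norm_num) x
    rwa [pow_zero, one_mul, ← hg] at this
  have bT0 : ∀ x, |g t x| ≤ K * T x := fun x => by
    have := bT 0 (by norm_num) x
    rwa [pow_zero, one_mul, ← hg] at this
  have bS1 : ∀ x, r * |GR μ δ t 1 x| ≤ K * S x := fun x => by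
    have := bS 1 (by norm_num) x
    rwa [pow_one] at this
  have bT1 : ∀ x, r * |GR μ δ t 1 x| ≤ K * T x := fun x => by
    have := bT 1 (by norm_num) x
    rwa [pow_one] at this
  have pKM : 0 < K * M := by positivity
  refine ⟨?_, ?_, ?_, ?_⟩
  · refine ((le_abs_self _).trans (bT0 x)).trans (mul_le_mul_of_nonneg_right ?_ (T0 x))
    linarith
  · refine (fin2 pr hK hM d1 bT0 bT1 T0 Ta Tc x u).trans ?_
    have := T0 x
    have := T0 (x + u)
    gcongr
    linarith
  · refine (fin3 pr hK d1 d2 (bT 2 le_rfl) T0 Ta x u).trans ?_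
    refine mul_le_mul_of_nonneg_right ?_ (Real.iSup_nonneg fun ξ => Real.iSup_nonneg fun _ => T0 ξ)
    gcongr
    linarith
  · refine (fin4 (M := 216) pr hK (by norm_num) d1 d2 bS0 bS1 (bS 2 le_rfl) S0 Sd x u w).trans ?_
    have := S0 (x + u)
    have := S0 (x - u)
    have := S0 (x + w)
    have := S0 (x - w)
    gcongr
    linarith
end

section
/- Let ε∈(0,1] and τ>0. For any t∈(0,τ] and x,x′∈ℝ, if |x−x′| ≤ h^{−1}(1/t)/4 and |x−x′| ≤ ε/4, then tilde-g_t^{(ε)}(x′) ≤ tilde-g_t^{(ε)}(x/2). -/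
open Filter

/-- if `|x-x'| ≤ h^{-1}(1/t)/4` and `|x-x'| ≤ ε/4` then
`tilde-g_t^{(ε)}(x') ≤ tilde-g_t^{(ε)}(x/2)`, for `t ∈ (0,τ]`. -/
theorem stmt_9 (d : ℕ) (hd : 1 ≤ d) (h hinv : ℝ → ℝ) (α β τ ε : ℝ)
    (hα : 0 < α) (hαβ : α ≤ β) (hβ : β < 2) (hτ : 0 < τ) (hε0 : 0 < ε) (hε1 : ε ≤ 1)
    (hpos : ∀ r : ℝ, 0 < r → 0 < h r)
    (hcont : ContinuousOn h (Set.Ioi 0))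
    (hanti : StrictAntiOn h (Set.Ioi 0))
    (hlim0 : Tendsto h (nhdsWithin 0 (Set.Ioi 0)) atTop)
    (hlimtop : Tendsto h atTop (nhds 0))
    (hinvpos : ∀ s : ℝ, 0 < s → 0 < hinv s)
    (hinvr : ∀ s : ℝ, 0 < s → h (hinv s) = s)
    (hinvl : ∀ r : ℝ, 0 < r → hinv (h r) = r) :
    ∀ t : ℝ, 0 < t → t ≤ τ → ∀ x x' : ℝ,
      |x - x'| ≤ hinv (1 / t) / 4 → |x - x'| ≤ ε / 4 →
      tg h hinv τ ε ((d + β - 1) / α) t x' ≤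
        tg h hinv τ ε ((d + β - 1) / α) t (x / 2) := by
  intro t ht htτ x x' hx1 hx2
  have hp : 1 ≤ ((d:ℝ) + β - 1) / α := by
    have : (1:ℝ) ≤ d := by exact_mod_cast hd
    rw [le_div_iff₀ hα]; linarith
  generalize ((d:ℝ) + β - 1) / α = p at hp ⊢
  have h1t : 0 < 1 / t := by positivity
  have h1τ : 0 < 1 / τ := by positivity
  have hHt := hinvpos _ h1t
  have hHτ := hinvpos _ h1τ
  have hhε := hpos ε hε0
  have hle : hinv (1 / t) ≤ hinv (1 / τ) := by
    by_contra hc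
    have hc := hanti (Set.mem_Ioi.2 hHτ) (Set.mem_Ioi.2 hHt) (not_le.1 hc)
    rw [hinvr _ h1t, hinvr _ h1τ] at hc
    have := one_div_le_one_div_of_le ht htτ
    linarith
  have hle2 : 1 / hinv (1 / τ) ≤ 1 / hinv (1 / t) := one_div_le_one_div_of_le hHt hle
  have hq : ∀ r s : ℝ, 0 < r → r ≤ s → t * h s / s ≤ t * h r / r := by
    intro r s hr hrs
    have := hanti.antitoneOn (Set.mem_Ioi.2 hr) (Set.mem_Ioi.2 (hr.trans_le hrs)) hrs
    have := hpos r hr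
    gcongr
  have hmpos : 0 < min (1 / hinv (1 / τ)) (τ * h ε / ε) := by
    apply lt_min <;> positivity
  have hout : ∀ r : ℝ, ε ≤ r →
      min (1 / hinv (1 / τ)) (τ * h ε / ε) * Real.exp ε / τ ^ p * (t ^ p * Real.exp (-r))
        ≤ min (1 / hinv (1 / t)) (t * h ε / ε) := by
    intro r hr
    have e1 : Real.exp ε * Real.exp (-r) ≤ 1 := by
      rw [← Real.exp_add, Real.exp_le_one_iff]; linarith
    have hs0 : 0 < t / τ := by positivity
    have hs1 : t / τ ≤ 1 := (div_le_one hτ).2 htτ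
    have e2 : t ^ p / τ ^ p ≤ t / τ := by
      rw [← Real.div_rpow ht.le hτ.le]
      simpa using Real.rpow_le_rpow_of_exponent_ge hs0 hs1 hp
    have e3 : 0 ≤ t ^ p / τ ^ p := by positivity
    generalize hm : min (1 / hinv (1 / τ)) (τ * h ε / ε) = m at hmpos ⊢
    have m1 : m ≤ 1 / hinv (1 / τ) := hm ▸ min_le_left _ _
    have m2 : m ≤ τ * h ε / ε := hm ▸ min_le_right _ _
    have e4 : m * Real.exp ε / τ ^ p * (t ^ p * Real.exp (-r)) ≤ m * (t / τ) := by
      calc _ = m * ((t ^ p / τ ^ p) * (Real.exp ε * Real.exp (-r))) := by ring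
        _ ≤ m * ((t / τ) * 1) := by gcongr
        _ = _ := by ring
    refine e4.trans (le_min ?_ ?_)
    · nlinarith
    · calc m * (t / τ) ≤ (τ * h ε / ε) * (t / τ) := by gcongr
        _ = t * h ε / ε := by field_simp
  have htop : ∀ y, tg h hinv τ ε p t y ≤ 1 / hinv (1 / t) := by
    intro y
    unfold tg
    split_ifs with c1 c2
    · exact le_rfl
    · exact min_le_left _ _
    · exact (hout _ (not_lt.1 c2)).trans (min_le_left _ _)
  by_cases hx0 : x / 2 = 0
  · have : tg h hinv τ ε p t (x / 2) = 1 / hinv (1 / t) := by simp [tg, hx0]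
    rw [this]; exact htop _
  have hxpos : 0 < |x / 2| := abs_pos.2 hx0
  rcases le_or_gt |x / 2| |x'| with hc | hc
  · have hx'0 : x' ≠ 0 := abs_pos.1 (hxpos.trans_le hc)
    unfold tg
    rw [if_neg hx0, if_neg hx'0]
    split_ifs with c1 c2 c2
    · exact min_le_min le_rfl (hq _ _ hxpos hc)
    · exact absurd (hc.trans_lt c1) c2
    · exact (hout _ (not_lt.1 c1)).trans (min_le_min le_rfl (hq _ _ hxpos c2.le))
    · gcongr
  · have h2 : |x / 2| = |x| / 2 := by rw [abs_div, abs_two]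
    have h3 := abs_sub_abs_le_abs_sub x x'
    have : tg h hinv τ ε p t (x / 2) = 1 / hinv (1 / t) := by
      unfold tg
      rw [if_neg hx0, if_pos (by linarith)]
      apply min_eq_left
      have := hq |x / 2| (hinv (1 / t)) hxpos (by linarith)
      rw [hinvr _ h1t] at this
      rwa [mul_one_div_cancel ht.ne'] at this
    rw [this]; exact htop _
end
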